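/- arXiv:2003.12782 — 3 statements merged into one kernel-verified Lean document; each statement's English description precedes it below -/
import Mathlib

section
/- For every Schwartz function u : ℝ² → ℝ and every x ∈ ℝ², the cube of the half-Laplacian of u, defined as the inverse Fourier integral ∫_{ℝ²} e^{2πi x·ξ} (2π|ξ|)³ ℱu(ξ) dξ, equals (9/(4π)) · lim_{ε→0⁺} ∫_{|y|>ε} ( u(x+y) + u(x−y) − 2u(x) − y₁² ∂₁²u(x) − y₂² ∂₂²u(x) ) |y|^{−5} dy, and this limit exists. -/
open Real MeasureTheory Filter Topology Set
open scoped ENNReal RealInnerProductSpace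

noncomputable section

/-- The forcing term `f_β(θ) = (β cos²θ + sin²θ)^(-5/2)`. -/
def fker (β θ : ℝ) : ℝ := (β * Real.cos θ ^ 2 + Real.sin θ ^ 2) ^ (-(5:ℝ)/2)

/-- `v` is a π-periodic, twice continuously differentiable solution of `v'' + 9 v = f_β`. -/
def IsVBeta (β : ℝ) (v : ℝ → ℝ) : Prop :=
  ContDiff ℝ 2 v ∧ Function.Periodic v π ∧
    ∀ θ : ℝ, deriv (deriv v) θ + 9 * v θ = fker β θ


abbrev R2 : Type := EuclideanSpace ℝ (Fin 2)

/-- The Fourier transform `ℱu(ξ) = ∫ e^{-2πi⟨z,ξ⟩} u(z) dz`. -/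
def FT (u : R2 → ℝ) (ξ : R2) : ℂ :=
  ∫ z : R2, Complex.exp (((-(2 * π * ⟪z, ξ⟫) : ℝ) : ℂ) * Complex.I) * (u z : ℂ)

/-- The pure second partial derivative `∂ᵢ² u (x)`. -/
def pderiv2 (u : R2 → ℝ) (i : Fin 2) (x : R2) : ℝ :=
  fderiv ℝ (fun z => fderiv ℝ u z (EuclideanSpace.single i 1)) x (EuclideanSpace.single i 1)

lemma two_mul_cos_sub_nonneg (s : ℝ) : 0 ≤ 2 * Real.cos s - 2 + s ^ 2 := by
  linarith [Real.one_sub_sq_div_two_le_cos (x := s)]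

lemma lintegral_two_mul_cos_sub_mul_exp (c : ℝ) {t : ℝ} (ht : 0 < t) :
    ∫⁻ r in Ioi (0 : ℝ), ENNReal.ofReal ((2 * Real.cos (c * r) - 2 + (c * r) ^ 2) *
      Real.exp (-(t * r))) = ENNReal.ofReal (2 * c ^ 4 / (t ^ 3 * (t ^ 2 + c ^ 2))) := by
  have hD : t ^ 2 + c ^ 2 ≠ 0 := by positivity
  let F : ℝ → ℝ := fun r => Real.exp (-(t * r)) *
    (2 * (c * Real.sin (c * r) - t * Real.cos (c * r)) / (t ^ 2 + c ^ 2) + 2 / t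
      - c ^ 2 * (r ^ 2 / t + 2 * r / t ^ 2 + 2 / t ^ 3))
  have hF : ∀ r ∈ Ici (0 : ℝ), HasDerivAt F ((2 * Real.cos (c * r) - 2 + (c * r) ^ 2) *
      Real.exp (-(t * r))) r := by
    intro r _
    have hl : HasDerivAt (fun r : ℝ => c * r) c r := by simpa using (hasDerivAt_id r).const_mul c
    have he : HasDerivAt (fun r : ℝ => Real.exp (-(t * r))) (Real.exp (-(t * r)) * (-t)) r := by
      have : HasDerivAt (fun r : ℝ => -(t * r)) (-t) r := by
        simpa using (hasDerivAt_id r).const_mul (-t)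
      exact this.exp
    have h1 := ((((hl.sin.const_mul c).sub (hl.cos.const_mul t)).const_mul 2).div_const
      (t ^ 2 + c ^ 2)).add_const (2 / t)
    have h2 := (((((hasDerivAt_id r).pow 2).div_const t).add
      (((hasDerivAt_id r).const_mul 2).div_const (t ^ 2))).add_const (2 / t ^ 3)).const_mul (c ^ 2)
    convert! he.mul (h1.sub h2) using 1
    simp
    field_simp
    ring
  have h0 : ∀ r ∈ Ioi (0 : ℝ), 0 ≤ (2 * Real.cos (c * r) - 2 + (c * r) ^ 2) *
      Real.exp (-(t * r)) := fun r _ =>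
    mul_nonneg (two_mul_cos_sub_nonneg _) (Real.exp_pos _).le
  have hlim : Tendsto F atTop (𝓝 0) := by
    have hp (n : ℕ) : Tendsto (fun r : ℝ => r ^ n * Real.exp (-(t * r))) atTop (𝓝 0) := by
      refine (((Real.tendsto_pow_mul_exp_neg_atTop_nhds_zero n).comp
        (tendsto_id.const_mul_atTop ht)).const_mul (t ^ n)⁻¹).congr' ?_ |>.trans (by simp)
      filter_upwards with r
      simp only [Function.comp, id, mul_pow]
      field_simp
    have hb : Tendsto (fun r : ℝ => (2 * (c * Real.sin (c * r) - t * Real.cos (c * r)) /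
        (t ^ 2 + c ^ 2) + 2 / t) * Real.exp (-(t * r))) atTop (𝓝 0) := by
      refine bdd_le_mul_tendsto_zero' (2 * (|c| + t) / (t ^ 2 + c ^ 2) + 2 / t)
        (Eventually.of_forall fun r => ?_) (by simpa using hp 0)
      refine (abs_add_le _ _).trans ?_
      rw [abs_div, abs_div, abs_of_pos ht, abs_two, abs_mul, abs_two,
        abs_of_pos (show 0 < t ^ 2 + c ^ 2 by positivity)]
      gcongr
      refine (abs_sub _ _).trans ?_
      rw [abs_mul, abs_mul, abs_of_pos ht]
      gcongr
      · exact mul_le_of_le_one_right (abs_nonneg _) (Real.abs_sin_le_one _)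
      · exact mul_le_of_le_one_right ht.le (Real.abs_cos_le_one _)
    have := ((hb.sub ((hp 2).const_mul (c ^ 2 / t))).sub ((hp 1).const_mul (2 * c ^ 2 / t ^ 2))).sub
      ((hp 0).const_mul (2 * c ^ 2 / t ^ 3))
    simp only [mul_zero, sub_zero] at this
    refine this.congr fun r => ?_
    simp only [F]
    ring
  rw [← ofReal_integral_eq_lintegral_ofReal (integrableOn_Ioi_deriv_of_nonneg' hF h0 hlim)
    (ae_restrict_of_forall_mem measurableSet_Ioi h0),
    integral_Ioi_of_hasDerivAt_of_nonneg' hF h0 hlim]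
  congr 1
  simp [F]
  field_simp
  ring

lemma lintegral_pow_three_mul_exp {r : ℝ} (hr : 0 < r) :
    ∫⁻ t in Ioi (0 : ℝ), ENNReal.ofReal (t ^ 3 / 6 * Real.exp (-(t * r))) =
      ENNReal.ofReal (1 / r ^ 4) := by
  have h := Real.integral_rpow_mul_exp_neg_mul_Ioi (a := 4) (r := r) (by norm_num) hr
  have hG : Real.Gamma 4 = 6 := by
    have := Real.Gamma_nat_eq_factorial 3
    norm_num [Nat.factorial] at this ⊢
  have h' : ∫ t in Ioi (0 : ℝ), t ^ 3 / 6 * Real.exp (-(t * r)) = 1 / r ^ 4 := by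
    have e : ∀ t ∈ Ioi (0 : ℝ), t ^ 3 / 6 * Real.exp (-(t * r)) =
        (1 / 6) * (t ^ ((4 : ℝ) - 1) * Real.exp (-(r * t))) := by
      intro t _
      rw [show ((4 : ℝ) - 1) = ((3 : ℕ) : ℝ) by norm_num, Real.rpow_natCast, mul_comm t r]
      ring
    rw [setIntegral_congr_fun measurableSet_Ioi e, integral_const_mul, h, hG,
      show (4 : ℝ) = ((4 : ℕ) : ℝ) by norm_num, Real.rpow_natCast]
    field_simp
  rw [← h', ofReal_integral_eq_lintegral_ofReal]
  · by_contra hn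
    rw [integral_undef hn] at h'
    have : 0 < 1 / r ^ 4 := by positivity
    linarith
  · refine ae_restrict_of_forall_mem measurableSet_Ioi fun t ht => ?_
    have : (0 : ℝ) < t := ht
    positivity

lemma lintegral_inv_sq_add_sq {c : ℝ} (hc : 0 < c) :
    ∫⁻ t in Ioi (0 : ℝ), ENNReal.ofReal (1 / (t ^ 2 + c ^ 2)) = ENNReal.ofReal (π / (2 * c)) := by
  have hF : ∀ t ∈ Ici (0 : ℝ), HasDerivAt (fun t => Real.arctan (t / c) / c)
      (1 / (t ^ 2 + c ^ 2)) t := by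
    intro t _
    convert! (((hasDerivAt_id t).div_const c).arctan).div_const c using 1
    simp
    field_simp
    rw [add_comm]
  have h0 : ∀ t ∈ Ioi (0 : ℝ), 0 ≤ 1 / (t ^ 2 + c ^ 2) := fun t _ => by positivity
  have hlim : Tendsto (fun t => Real.arctan (t / c) / c) atTop (𝓝 (π / 2 / c)) :=
    ((tendsto_nhds_of_tendsto_nhdsWithin Real.tendsto_arctan_atTop).comp
      (tendsto_id.atTop_div_const hc)).div_const c
  rw [← ofReal_integral_eq_lintegral_ofReal (integrableOn_Ioi_deriv_of_nonneg' hF h0 hlim)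
    (ae_restrict_of_forall_mem measurableSet_Ioi h0),
    integral_Ioi_of_hasDerivAt_of_nonneg' hF h0 hlim]
  congr 1
  simp
  field_simp

lemma lintegral_two_mul_cos_sub_div_pow_four {c : ℝ} (hc : 0 < c) :
    ∫⁻ r in Ioi (0 : ℝ), ENNReal.ofReal ((2 * Real.cos (c * r) - 2 + (c * r) ^ 2) / r ^ 4) =
      ENNReal.ofReal (π / 6 * c ^ 3) := by
  calc
    _ = ∫⁻ r in Ioi (0 : ℝ), ∫⁻ t in Ioi (0 : ℝ),
        ENNReal.ofReal ((2 * Real.cos (c * r) - 2 + (c * r) ^ 2)) *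
          ENNReal.ofReal (t ^ 3 / 6 * Real.exp (-(t * r))) := by
      refine setLIntegral_congr_fun measurableSet_Ioi fun r hr => ?_
      rw [lintegral_const_mul _ (by fun_prop), lintegral_pow_three_mul_exp hr,
        ← ENNReal.ofReal_mul (two_mul_cos_sub_nonneg _), mul_one_div]
    _ = ∫⁻ t in Ioi (0 : ℝ), ∫⁻ r in Ioi (0 : ℝ),
        ENNReal.ofReal ((2 * Real.cos (c * r) - 2 + (c * r) ^ 2)) *
          ENNReal.ofReal (t ^ 3 / 6 * Real.exp (-(t * r))) :=
      lintegral_lintegral_swap (by fun_prop)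
    _ = ∫⁻ t in Ioi (0 : ℝ), ENNReal.ofReal (c ^ 4 / 3) * ENNReal.ofReal (1 / (t ^ 2 + c ^ 2)) := by
      refine setLIntegral_congr_fun measurableSet_Ioi fun t ht => ?_
      have ht : (0 : ℝ) < t := ht
      have e (r : ℝ) : ENNReal.ofReal ((2 * Real.cos (c * r) - 2 + (c * r) ^ 2)) *
          ENNReal.ofReal (t ^ 3 / 6 * Real.exp (-(t * r))) = ENNReal.ofReal (t ^ 3 / 6) *
          ENNReal.ofReal ((2 * Real.cos (c * r) - 2 + (c * r) ^ 2) * Real.exp (-(t * r))) := by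
        rw [← ENNReal.ofReal_mul (two_mul_cos_sub_nonneg _), ← ENNReal.ofReal_mul (by positivity)]
        congr 1
        ring
      simp_rw [e]
      rw [lintegral_const_mul _ (by fun_prop), lintegral_two_mul_cos_sub_mul_exp c ht,
        ← ENNReal.ofReal_mul (by positivity), ← ENNReal.ofReal_mul (by positivity)]
      congr 1
      field_simp
      ring
    _ = _ := by
      rw [lintegral_const_mul _ (by fun_prop), lintegral_inv_sq_add_sq hc,
        ← ENNReal.ofReal_mul (by positivity)]
      congr 1
      field_simp
      ring

lemma lintegral_abs_cos_pow_three :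
    ∫⁻ θ in Ioo (-π) π, ENNReal.ofReal (|Real.cos θ| ^ 3) = ENNReal.ofReal (8 / 3) := by
  have hi (a b : ℝ) : IntervalIntegrable (fun θ => |Real.cos θ| ^ 3) volume a b :=
    Continuous.intervalIntegrable (by fun_prop) _ _
  have hper : Function.Periodic (fun θ => |Real.cos θ| ^ 3) π := fun θ => by
    simp [Real.cos_add_pi]
  have hhalf : ∫ θ in (-(π / 2))..(π / 2), |Real.cos θ| ^ 3 = 4 / 3 := by
    have : ∫ θ in (-(π / 2))..(π / 2), |Real.cos θ| ^ 3 =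
        ∫ θ in (-(π / 2))..(π / 2), Real.cos θ ^ 3 := by
      refine intervalIntegral.integral_congr fun θ hθ => ?_
      rw [uIcc_of_le (by linarith [Real.pi_pos])] at hθ
      rw [abs_of_nonneg (Real.cos_nonneg_of_mem_Icc hθ)]
    rw [this, integral_cos_pow_three]
    simp
    norm_num
  have hp (a : ℝ) : ∫ θ in a..(a + π), |Real.cos θ| ^ 3 = 4 / 3 := by
    rw [hper.intervalIntegral_add_eq a (-(π / 2)), ← hhalf]
    congr 1
    ring
  have htot : ∫ θ in (-π)..π, |Real.cos θ| ^ 3 = 8 / 3 := by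
    have h1 := hp (-π)
    have h2 := hp 0
    rw [neg_add_cancel] at h1
    rw [zero_add] at h2
    rw [← intervalIntegral.integral_add_adjacent_intervals (hi _ 0) (hi _ _), h1, h2]
    norm_num
  rw [restrict_Ioo_eq_restrict_Ioc, ← htot, intervalIntegral.integral_of_le (by linarith [Real.pi_pos]),
    ofReal_integral_eq_lintegral_ofReal]
  · exact (hi _ _).1
  · exact Eventually.of_forall fun θ => by positivity

lemma lintegral_two_mul_cos_sub_div_pow_four_abs (c : ℝ) :
    ∫⁻ r in Ioi (0 : ℝ), ENNReal.ofReal ((2 * Real.cos (c * r) - 2 + (c * r) ^ 2) / r ^ 4) =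
      ENNReal.ofReal (π / 6 * |c| ^ 3) := by
  rcases lt_trichotomy c 0 with hc | rfl | hc
  · rw [abs_of_neg hc, ← lintegral_two_mul_cos_sub_div_pow_four (neg_pos.2 hc)]
    simp
  · simp
  · rw [abs_of_pos hc, lintegral_two_mul_cos_sub_div_pow_four hc]

lemma lintegral_complex_two_mul_cos_re_sub {a : ℝ} (ha : 0 ≤ a) :
    ∫⁻ z : ℂ, ENNReal.ofReal ((2 * Real.cos (a * z.re) - 2 + (a * z.re) ^ 2) / ‖z‖ ^ 5) =
      ENNReal.ofReal (4 * π / 9 * a ^ 3) := by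
  rw [← Complex.lintegral_comp_polarCoord_symm, polarCoord_target, Measure.volume_eq_prod,
    ← Measure.prod_restrict, lintegral_prod_symm' _ (by simp; fun_prop)]
  calc
    _ = ∫⁻ θ in Ioo (-π) π, ENNReal.ofReal (π / 6 * a ^ 3) *
        ENNReal.ofReal (|Real.cos θ| ^ 3) := by
      refine lintegral_congr fun θ => ?_
      rw [← ENNReal.ofReal_mul (by positivity),
        show π / 6 * a ^ 3 * |Real.cos θ| ^ 3 = π / 6 * |a * Real.cos θ| ^ 3 by
          rw [abs_mul, abs_of_nonneg ha]; ring,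
        ← lintegral_two_mul_cos_sub_div_pow_four_abs]
      refine setLIntegral_congr_fun measurableSet_Ioi fun r hr => ?_
      have hr : (0 : ℝ) < r := hr
      have h1 : (Complex.polarCoord.symm (r, θ)).re = Real.cos θ * r := by
        simp [Complex.cos_ofReal_re, mul_comm]
      simp only [Complex.norm_polarCoord_symm, abs_of_pos hr, h1, smul_eq_mul]
      rw [← ENNReal.ofReal_mul hr.le, mul_assoc a]
      congr 1
      field_simp
    _ = _ := by
      rw [lintegral_const_mul _ (by fun_prop), lintegral_abs_cos_pow_three,
        ← ENNReal.ofReal_mul (by positivity)]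
      congr 1
      ring

lemma exists_linearIsometryEquiv_inner_eq (k : EuclideanSpace ℝ (Fin 2)) :
    ∃ e : ℂ ≃ₗᵢ[ℝ] EuclideanSpace ℝ (Fin 2), ∀ z, ⟪e z, k⟫ = ‖k‖ * z.re := by
  let φ : ℂ ≃ₗᵢ[ℝ] EuclideanSpace ℝ (Fin 2) := Complex.orthonormalBasisOneI.repr
  obtain ⟨w, rfl⟩ := φ.surjective k
  refine ⟨(rotation (Circle.exp (Complex.arg w))).trans φ, fun z => ?_⟩
  rw [LinearIsometryEquiv.trans_apply, φ.inner_map_map, φ.norm_map, rotation_apply]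
  have hw := Complex.norm_mul_exp_arg_mul_I w
  rw [Circle.coe_exp]
  set c := Complex.exp (Complex.arg w * Complex.I) with hc
  have hcc : c * (starRingEnd ℂ) c = 1 := by
    rw [Complex.mul_conj, Complex.normSq_eq_norm_sq, hc, Complex.norm_exp_ofReal_mul_I]
    simp
  have : (starRingEnd ℂ) (c * z) * w = ‖w‖ * (starRingEnd ℂ) z := by
    conv_lhs => rw [← hw]
    rw [map_mul]
    linear_combination (‖w‖ * (starRingEnd ℂ) z) * hcc
  rw [Complex.inner, mul_comm w, this]
  simp

lemma lintegral_two_mul_cos_inner_sub (k : EuclideanSpace ℝ (Fin 2)) :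
    ∫⁻ y : EuclideanSpace ℝ (Fin 2), ENNReal.ofReal ((2 * Real.cos ⟪y, k⟫ - 2 + ⟪y, k⟫ ^ 2) / ‖y‖ ^ 5) =
      ENNReal.ofReal (4 * π / 9 * ‖k‖ ^ 3) := by
  obtain ⟨e, he⟩ := exists_linearIsometryEquiv_inner_eq k
  rw [← lintegral_complex_two_mul_cos_re_sub (norm_nonneg k),
    ← e.measurePreserving.lintegral_comp_emb e.toHomeomorph.measurableEmbedding]
  simp [he]

open scoped FourierTransform SchwartzMap LineDeriv

/-- A real-valued Schwartz function, viewed as a complex-valued one. -/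
def complexify (u : 𝓢(R2, ℝ)) : 𝓢(R2, ℂ) := u.postcompCLM Complex.ofRealCLM

@[simp]
lemma complexify_apply (u : 𝓢(R2, ℝ)) (x : R2) : complexify u x = (u x : ℂ) := rfl

lemma FT_eq_fourier_complexify (u : 𝓢(R2, ℝ)) (ξ : R2) : FT u ξ = 𝓕 (complexify u) ξ := by
  rw [SchwartzMap.fourier_coe, Real.fourier_eq', FT]
  simp

lemma SchwartzMap.eq_integral_fourier (f : 𝓢(R2, ℂ)) (z : R2) :
    f z = ∫ ξ, Complex.exp (((2 * π * ⟪z, ξ⟫ : ℝ) : ℂ) * Complex.I) * 𝓕 f ξ := by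
  have h : 𝓕⁻ (𝓕 f : 𝓢(R2, ℂ)) = f := FourierTransform.fourierInv_fourier_eq f
  conv_lhs => rw [← h, SchwartzMap.fourierInv_coe,
    Real.fourierInv_eq']
  simp_rw [real_inner_comm z, smul_eq_mul]

lemma lineDerivOp_complexify (u : 𝓢(R2, ℝ)) (m : R2) :
    ∂_{m} (complexify u) = complexify (∂_{m} u) := by
  ext x
  rw [complexify_apply, SchwartzMap.lineDerivOp_apply_eq_fderiv,
    SchwartzMap.lineDerivOp_apply_eq_fderiv]
  have h := (Complex.ofRealCLM.hasFDerivAt (x := u x)).comp x (u.hasFDerivAt x)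
  have h2 : (complexify u : R2 → ℂ) = Complex.ofRealCLM ∘ u := rfl
  rw [h2, h.fderiv]
  rfl

lemma pderiv2_eq_integral_fourier (u : 𝓢(R2, ℝ)) (i : Fin 2) (x : R2) :
    (pderiv2 u i x : ℂ) = ∫ ξ, Complex.exp (((2 * π * ⟪x, ξ⟫ : ℝ) : ℂ) * Complex.I) *
      (-((2 * π * ξ i : ℝ) : ℂ) ^ 2 * 𝓕 (complexify u) ξ) := by
  have h : (pderiv2 u i x : ℂ) =
      ∂_{EuclideanSpace.single i (1 : ℝ)} (∂_{EuclideanSpace.single i (1 : ℝ)} (complexify u)) x := by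
    rw [lineDerivOp_complexify, lineDerivOp_complexify]
    rfl
  rw [h, SchwartzMap.eq_integral_fourier]
  refine integral_congr_ae (Eventually.of_forall fun ξ => ?_)
  have ht : (inner ℝ · (EuclideanSpace.single i (1 : ℝ)) : R2 → ℝ).HasTemperateGrowth := by fun_prop
  simp only [SchwartzMap.fourier_lineDerivOp_eq, _root_.smul_apply,
    SchwartzMap.smulLeftCLM_apply_apply ht]
  simp [EuclideanSpace.inner_single_right]
  linear_combination (4 * π ^ 2 * (ξ i : ℂ) ^ 2 * 𝓕 (complexify u) ξ *
    Complex.exp (2 * π * (⟪x, ξ⟫ : ℝ) * Complex.I)) * Complex.I_sq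

/-- The homogeneous kernel `(2 cos s - 2 + s²) / |y|⁵` with `s = 2π⟪y, ξ⟫`. -/
def symbolKernel (y ξ : R2) : ℝ :=
  (2 * Real.cos (2 * π * ⟪y, ξ⟫) - 2 + (2 * π * ⟪y, ξ⟫) ^ 2) / ‖y‖ ^ 5

lemma symbolKernel_nonneg (y ξ : R2) : 0 ≤ symbolKernel y ξ :=
  div_nonneg (two_mul_cos_sub_nonneg _) (by positivity)

lemma measurable_symbolKernel : Measurable fun p : R2 × R2 => symbolKernel p.1 p.2 := by
  unfold symbolKernel
  fun_prop

lemma lintegral_symbolKernel (ξ : R2) :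
    ∫⁻ y, ENNReal.ofReal (symbolKernel y ξ) =
      ENNReal.ofReal (4 * π / 9 * (2 * π * ‖ξ‖) ^ 3) := by
  have := lintegral_two_mul_cos_inner_sub ((2 * π) • ξ)
  simp only [inner_smul_right, norm_smul, Real.norm_eq_abs, abs_of_pos Real.two_pi_pos] at this
  exact this

lemma integrable_symbolKernel (ξ : R2) : Integrable fun y => symbolKernel y ξ := by
  refine ⟨(measurable_symbolKernel.comp measurable_prodMk_right).aestronglyMeasurable, ?_⟩
  rw [hasFiniteIntegral_iff_ofReal (Eventually.of_forall fun y => symbolKernel_nonneg y ξ),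
    lintegral_symbolKernel]
  exact ENNReal.ofReal_lt_top

lemma integral_symbolKernel (ξ : R2) :
    ∫ y, symbolKernel y ξ = 4 * π / 9 * (2 * π * ‖ξ‖) ^ 3 := by
  rw [integral_eq_lintegral_of_nonneg_ae (Eventually.of_forall fun y => symbolKernel_nonneg y ξ)
    (integrable_symbolKernel ξ).1, lintegral_symbolKernel, ENNReal.toReal_ofReal (by positivity)]

lemma integrable_const_mul_symbolKernel_mul_const (ξ : R2) (a b : ℂ) :
    Integrable fun y => a * ((symbolKernel y ξ : ℝ) : ℂ) * b :=
  ((integrable_symbolKernel ξ).ofReal (𝕜 := ℂ) |>.const_mul a).mul_const b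

lemma measurable_exp_mul_symbolKernel_mul {g : R2 → ℂ} (hg : Measurable g) (x : R2) :
    Measurable fun p : R2 × R2 => Complex.exp (((2 * π * ⟪x, p.2⟫ : ℝ) : ℂ) * Complex.I) *
      ((symbolKernel p.1 p.2 : ℝ) : ℂ) * g p.2 := by
  have h1 : Measurable fun p : R2 × R2 =>
      Complex.exp (((2 * π * ⟪x, p.2⟫ : ℝ) : ℂ) * Complex.I) := by fun_prop
  have h2 : Measurable fun p : R2 × R2 => ((symbolKernel p.1 p.2 : ℝ) : ℂ) :=
    Complex.measurable_ofReal.comp measurable_symbolKernel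
  exact (h1.mul h2).mul (hg.comp measurable_snd)

lemma integral_norm_exp_mul_symbolKernel_mul (g : R2 → ℂ) (x ξ : R2) :
    ∫ y, ‖Complex.exp (((2 * π * ⟪x, ξ⟫ : ℝ) : ℂ) * Complex.I) *
      ((symbolKernel y ξ : ℝ) : ℂ) * g ξ‖ = 4 * π / 9 * (2 * π) ^ 3 * (‖ξ‖ ^ 3 * ‖g ξ‖) := by
  simp_rw [norm_mul, Complex.norm_exp_ofReal_mul_I, one_mul, Complex.norm_real,
    Real.norm_eq_abs, abs_of_nonneg (symbolKernel_nonneg _ _)]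
  rw [integral_mul_const, integral_symbolKernel]
  ring

lemma SchwartzMap.integrable_exp_mul_symbolKernel_mul (g : 𝓢(R2, ℂ)) (x : R2) :
    Integrable (fun p : R2 × R2 => Complex.exp (((2 * π * ⟪x, p.2⟫ : ℝ) : ℂ) * Complex.I) *
      ((symbolKernel p.1 p.2 : ℝ) : ℂ) * g p.2) (volume.prod volume) := by
  have hm := measurable_exp_mul_symbolKernel_mul g.continuous.measurable x
  refine (integrable_prod_iff' hm.aestronglyMeasurable).2 ⟨?_, ?_⟩
  · exact Eventually.of_forall fun ξ => integrable_const_mul_symbolKernel_mul_const ξ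
      (Complex.exp (((2 * π * ⟪x, ξ⟫ : ℝ) : ℂ) * Complex.I)) (g ξ)
  · simp only [integral_norm_exp_mul_symbolKernel_mul (⇑g) x]
    exact (g.integrable_pow_mul volume 3).const_mul _

lemma integrableOn_mul_div_norm_pow_five {ε : ℝ} (hε : 0 < ε) :
    IntegrableOn (fun y : R2 => y 0 * y 1 / ‖y‖ ^ 5) {y : R2 | ε < ‖y‖} := by
  have hm : MeasurableSet {y : R2 | ε < ‖y‖} := measurableSet_lt measurable_const measurable_norm
  have hi : Integrable (fun y : R2 => (1 + ‖y‖) ^ (-(3 : ℝ))) :=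
    integrable_one_add_norm (by simp; norm_num)
  refine Integrable.mono' (hi.const_mul ((1 + 1 / ε) ^ 3)).integrableOn
    (Measurable.aestronglyMeasurable (by fun_prop)) ?_
  refine ae_restrict_of_forall_mem hm fun y hy => ?_
  have hy : ε < ‖y‖ := hy
  have hy0 : 0 < ‖y‖ := hε.trans hy
  have h0 : |y 0| ≤ ‖y‖ := PiLp.norm_apply_le y 0
  have h1 : |y 1| ≤ ‖y‖ := PiLp.norm_apply_le y 1
  rw [norm_div, norm_mul, norm_pow, norm_norm, Real.rpow_neg (by positivity),
    show (3 : ℝ) = ((3 : ℕ) : ℝ) by norm_num, Real.rpow_natCast, ← div_eq_mul_inv, ← div_pow]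
  calc |y 0| * |y 1| / ‖y‖ ^ 5 ≤ ‖y‖ * ‖y‖ / ‖y‖ ^ 5 := by gcongr
    _ = (1 / ‖y‖) ^ 3 := by field_simp
    _ ≤ _ := by
      gcongr ?_ ^ 3
      rw [div_le_div_iff₀ hy0 (by positivity)]
      have : 1 ≤ ‖y‖ / ε := (one_le_div hε).2 hy.le
      calc 1 * (1 + ‖y‖) ≤ ‖y‖ / ε + ‖y‖ := by linarith
        _ = _ := by ring

lemma setIntegral_mul_div_norm_pow_five (ε : ℝ) :
    ∫ y in {y : R2 | ε < ‖y‖}, y 0 * y 1 / ‖y‖ ^ 5 = 0 := by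
  let e : R2 ≃ₗᵢ[ℝ] R2 := LinearIsometryEquiv.piLpCongrRight 2
    ![LinearIsometryEquiv.neg ℝ, LinearIsometryEquiv.refl ℝ ℝ]
  have he0 (y : R2) : e y 0 = -y 0 := rfl
  have he1 (y : R2) : e y 1 = y 1 := rfl
  have h := e.measurePreserving.setIntegral_preimage_emb e.toHomeomorph.measurableEmbedding
    (fun y : R2 => y 0 * y 1 / ‖y‖ ^ 5) {y : R2 | ε < ‖y‖}
  have hs : e ⁻¹' {y : R2 | ε < ‖y‖} = {y : R2 | ε < ‖y‖} := by
    ext y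
    simp
  simp only [hs, he0, he1, LinearIsometryEquiv.norm_map, neg_mul, neg_div, integral_neg] at h
  linarith

lemma second_difference_eq_integral_symbolKernel (u : 𝓢(R2, ℝ)) (x y : R2) :
    (((u (x + y) + u (x - y) - 2 * u x
        - (y 0)^2 * pderiv2 (⇑u) 0 x - (y 1)^2 * pderiv2 (⇑u) 1 x) / ‖y‖^5 : ℝ) : ℂ) =
      (∫ ξ, Complex.exp (((2 * π * ⟪x, ξ⟫ : ℝ) : ℂ) * Complex.I) *
        ((symbolKernel y ξ : ℝ) : ℂ) * 𝓕 (complexify u) ξ) -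
      (∫ ξ, Complex.exp (((2 * π * ⟪x, ξ⟫ : ℝ) : ℂ) * Complex.I) *
        ((8 * π ^ 2 * (ξ 0 * ξ 1) : ℝ) : ℂ) * 𝓕 (complexify u) ξ) *
        ((y 0 * y 1 / ‖y‖ ^ 5 : ℝ) : ℂ) := by
  set g := 𝓕 (complexify u) with hg
  have hexp (z : R2) (h : R2 → ℂ) (hh : Integrable h) : Integrable fun ξ : R2 =>
      Complex.exp (((2 * π * ⟪z, ξ⟫ : ℝ) : ℂ) * Complex.I) * h ξ := by
    refine hh.bdd_mul (c := 1) (Continuous.aestronglyMeasurable (by fun_prop))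
      (Eventually.of_forall fun ξ => ?_)
    rw [Complex.norm_exp_ofReal_mul_I]
  have hq (i j : Fin 2) (c : ℝ) : Integrable fun ξ : R2 => ((c * (ξ i * ξ j) : ℝ) : ℂ) * g ξ := by
    refine Integrable.mono' ((g.integrable_pow_mul volume 2).const_mul |c|)
      (Continuous.aestronglyMeasurable (by have := g.continuous; fun_prop))
      (Eventually.of_forall fun ξ => ?_)
    have h0 : |ξ i| ≤ ‖ξ‖ := PiLp.norm_apply_le ξ i
    have h1 : |ξ j| ≤ ‖ξ‖ := PiLp.norm_apply_le ξ j
    rw [norm_mul, Complex.norm_real, Real.norm_eq_abs, abs_mul, abs_mul, pow_two, mul_assoc]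
    gcongr
  have hu (z : R2) : (u z : ℂ) =
      ∫ ξ, Complex.exp (((2 * π * ⟪z, ξ⟫ : ℝ) : ℂ) * Complex.I) * g ξ :=
    SchwartzMap.eq_integral_fourier (complexify u) z
  have hp (i : Fin 2) : (pderiv2 u i x : ℂ) = ∫ ξ,
      Complex.exp (((2 * π * ⟪x, ξ⟫ : ℝ) : ℂ) * Complex.I) *
        (((-(4 * π ^ 2) * (ξ i * ξ i) : ℝ) : ℂ) * g ξ) := by
    rw [pderiv2_eq_integral_fourier]
    refine integral_congr_ae (Eventually.of_forall fun ξ => ?_)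
    push_cast
    ring
  have hc : (∫ ξ, Complex.exp (((2 * π * ⟪x, ξ⟫ : ℝ) : ℂ) * Complex.I) *
        ((8 * π ^ 2 * (ξ 0 * ξ 1) : ℝ) : ℂ) * g ξ) =
      ∫ ξ, Complex.exp (((2 * π * ⟪x, ξ⟫ : ℝ) : ℂ) * Complex.I) *
        (((8 * π ^ 2 * (ξ 0 * ξ 1) : ℝ) : ℂ) * g ξ) := by
    simp_rw [mul_assoc]
  rw [hc]
  set c := ∫ ξ, Complex.exp (((2 * π * ⟪x, ξ⟫ : ℝ) : ℂ) * Complex.I) *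
    (((8 * π ^ 2 * (ξ 0 * ξ 1) : ℝ) : ℂ) * g ξ) with hc_def
  set S := ∫ ξ, Complex.exp (((2 * π * ⟪x, ξ⟫ : ℝ) : ℂ) * Complex.I) *
    ((symbolKernel y ξ : ℝ) : ℂ) * g ξ with hS_def
  push_cast
  rw [hu, hu, hu, hp, hp, hc_def, hS_def, eq_sub_iff_add_eq, ← mul_div_assoc, ← add_div]
  have i1 := hexp (x + y) g g.integrable
  have i2 := hexp (x - y) g g.integrable
  have i3 := (hexp x g g.integrable).const_mul 2
  have i4 := (hexp x _ (hq 0 0 (-(4 * π ^ 2)))).const_mul ((y 0 : ℂ) ^ 2)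
  have i5 := (hexp x _ (hq 1 1 (-(4 * π ^ 2)))).const_mul ((y 1 : ℂ) ^ 2)
  have i6 := (hexp x _ (hq 0 1 (8 * π ^ 2))).mul_const ((y 0 : ℂ) * (y 1 : ℂ))
  rw [← integral_const_mul, ← integral_const_mul, ← integral_const_mul, ← integral_mul_const,
    ← integral_add' i1 i2, ← integral_sub' (i1.add i2) i3, ← integral_sub' ((i1.add i2).sub i3) i4,
    ← integral_sub' (((i1.add i2).sub i3).sub i4) i5,
    ← integral_add' ((((i1.add i2).sub i3).sub i4).sub i5) i6, ← integral_div]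
  refine integral_congr_ae (Eventually.of_forall fun ξ => ?_)
  have hy : ⟪y, ξ⟫ = y 0 * ξ 0 + y 1 * ξ 1 := by
    simp [PiLp.inner_apply, Fin.sum_univ_two, mul_comm]
  have e1 : Complex.exp (((2 * π * ⟪x + y, ξ⟫ : ℝ) : ℂ) * Complex.I) =
      Complex.exp (((2 * π * ⟪x, ξ⟫ : ℝ) : ℂ) * Complex.I) *
        Complex.exp (((2 * π * ⟪y, ξ⟫ : ℝ) : ℂ) * Complex.I) := by
    rw [← Complex.exp_add, inner_add_left]
    push_cast
    ring_nf
  have e2 : Complex.exp (((2 * π * ⟪x - y, ξ⟫ : ℝ) : ℂ) * Complex.I) =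
      Complex.exp (((2 * π * ⟪x, ξ⟫ : ℝ) : ℂ) * Complex.I) *
        Complex.exp (-((2 * π * ⟪y, ξ⟫ : ℝ) : ℂ) * Complex.I) := by
    rw [← Complex.exp_add, inner_sub_left]
    push_cast
    ring_nf
  have e3 := Complex.two_cos ((2 * π * ⟪y, ξ⟫ : ℝ) : ℂ)
  simp only [Pi.add_apply, Pi.sub_apply, e1, e2, symbolKernel]
  set E := Complex.exp (((2 * π * ⟪x, ξ⟫ : ℝ) : ℂ) * Complex.I)
  have hs : ((2 * π * ⟪y, ξ⟫ : ℝ) : ℂ) = 2 * π * ((y 0 : ℂ) * ξ 0 + (y 1 : ℂ) * ξ 1) := by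
    rw [hy]
    push_cast
    ring
  set s := 2 * π * ⟪y, ξ⟫
  rw [Complex.ofReal_div, Complex.ofReal_pow ‖y‖, ← mul_div_assoc, div_mul_eq_mul_div]
  congr 1
  push_cast
  linear_combination (-(E * g ξ)) * e3 -
    (E * g ξ) * (s + 2 * π * ((y 0 : ℂ) * ξ 0 + (y 1 : ℂ) * ξ 1)) * hs

/-- the cube of the half-Laplacian of a Schwartz function, i.e. the inverse
Fourier integral of `(2π|ξ|)³ ℱu(ξ)`, equals `9/(4π)` times the principal value integral
`lim_{ε→0⁺} ∫_{|y|>ε} (u(x+y)+u(x−y)−2u(x)−y₁²∂₁²u(x)−y₂²∂₂²u(x)) |y|^{−5} dy`,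
and this limit exists. -/
theorem stmt8 (u : SchwartzMap R2 ℝ) (x : R2) :
    ∃ L : ℝ,
      Tendsto (fun ε : ℝ => ∫ y in {y : R2 | ε < ‖y‖},
          (u (x + y) + u (x - y) - 2 * u x
            - (y 0)^2 * pderiv2 (⇑u) 0 x - (y 1)^2 * pderiv2 (⇑u) 1 x) / ‖y‖^5)
        (𝓝[>] (0:ℝ)) (𝓝 L) ∧
      (∫ ξ : R2, Complex.exp (((2 * π * ⟪x, ξ⟫ : ℝ) : ℂ) * Complex.I)
          * (((2 * π * ‖ξ‖)^3 : ℝ) : ℂ) * FT (⇑u) ξ)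
        = (((9 / (4 * π)) * L : ℝ) : ℂ) := by
  set g := 𝓕 (complexify u) with hg
  set H : R2 → ℂ := fun y => ∫ ξ, Complex.exp (((2 * π * ⟪x, ξ⟫ : ℝ) : ℂ) * Complex.I) *
    ((symbolKernel y ξ : ℝ) : ℂ) * g ξ with hH
  have hint := g.integrable_exp_mul_symbolKernel_mul x
  have hHi : Integrable H := hint.integral_prod_left
  have hcover : AECover (volume : Measure R2) (𝓝[>] (0 : ℝ)) fun ε => {y : R2 | ε < ‖y‖} := by
    refine ⟨?_, fun ε => measurableSet_lt measurable_const measurable_norm⟩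
    filter_upwards [compl_mem_ae_iff.2 (measure_singleton (0 : R2))] with y hy
    exact nhdsWithin_le_nhds (Iio_mem_nhds (norm_pos_iff.2 hy))
  have htends := hcover.integral_tendsto_of_countably_generated hHi
  set J : ℝ → ℝ := fun ε => ∫ y in {y : R2 | ε < ‖y‖},
          (u (x + y) + u (x - y) - 2 * u x
            - (y 0)^2 * pderiv2 (⇑u) 0 x - (y 1)^2 * pderiv2 (⇑u) 1 x) / ‖y‖^5 with hJ
  have hJ' : Tendsto (fun ε => (J ε : ℂ)) (𝓝[>] 0) (𝓝 (∫ y, H y)) := by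
    refine htends.congr' ?_
    filter_upwards [self_mem_nhdsWithin] with ε hε
    have hdiff := second_difference_eq_integral_symbolKernel u x
    change ∀ y, _ = H y - _ * _ at hdiff
    have hk : IntegrableOn (fun y : R2 => ((y 0 * y 1 / ‖y‖ ^ 5 : ℝ) : ℂ)) {y : R2 | ε < ‖y‖} :=
      Integrable.ofReal (integrableOn_mul_div_norm_pow_five hε)
    rw [hJ, ← integral_complex_ofReal]
    simp_rw [hdiff]
    rw [integral_sub hHi.integrableOn (hk.const_mul _), integral_const_mul,
      integral_complex_ofReal, setIntegral_mul_div_norm_pow_five]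
    simp
  have hre : Tendsto J (𝓝[>] 0) (𝓝 (∫ y, H y).re) :=
    (Complex.continuous_re.tendsto _).comp hJ'
  have hL : (((∫ y, H y).re : ℝ) : ℂ) = ∫ y, H y :=
    tendsto_nhds_unique ((Complex.continuous_ofReal.tendsto _).comp hre) hJ'
  refine ⟨_, hre, ?_⟩
  rw [Complex.ofReal_mul, hL, hH, integral_integral_swap hint, ← integral_const_mul]
  refine integral_congr_ae (Eventually.of_forall fun ξ => ?_)
  have hπ : (π : ℂ) ≠ 0 := Complex.ofReal_ne_zero.2 Real.pi_ne_zero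
  simp only
  rw [integral_mul_const, integral_const_mul, integral_complex_ofReal, integral_symbolKernel,
    FT_eq_fourier_complexify, ← hg]
  push_cast
  field_simp
end
end

section
/- Let β ∈ [1/2, 2] and define the kernel K(y) := 9 v_β(θ̃(y)) / (y₁²/β + y₂²)^{3/2} for y = (y₁, y₂) ∈ ℝ² \ {0}, where θ̃(y) is a polar angle of the point (y₁/√β, y₂). Then for every Schwartz function u : ℝ² → ℝ and every x ∈ ℝ², ∫_{ℝ²} e^{2πi x·ξ} · (2π |ξ|³ / (β ξ₁² + ξ₂²)) · ℱu(ξ) dξ = −(1/(4π)) ∫_{ℝ²} ( u(x+y) + u(x−y) − 2u(x) ) K(y) dy, where both integrals converge absolutely. -/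
open Real MeasureTheory Filter Topology Set
open scoped ENNReal RealInnerProductSpace

noncomputable section

/-- The anisotropic kernel `K(y) = 9 v(θ̃(y)) / (y₁²/β + y₂²)^{3/2}`, where `θ̃(y)` is a
polar angle of `(y₁/√β, y₂)` (chosen as `Complex.arg`; immaterial since `v` is π-periodic). -/
def Kani (β : ℝ) (v : ℝ → ℝ) (y : R2) : ℝ :=
  9 * v (Complex.arg (((y 0 / Real.sqrt β : ℝ) : ℂ) + ((y 1 : ℝ) : ℂ) * Complex.I))
    / ((y 0)^2 / β + (y 1)^2) ^ ((3:ℝ)/2)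

lemma laplace_one_sub_cos (a : ℝ) {t : ℝ} (ht : 0 < t) :
    IntegrableOn (fun r => t * rexp (-(t * r)) * (1 - Real.cos (a * r))) (Ioi 0) ∧
    ∫ r in Ioi (0:ℝ), t * rexp (-(t * r)) * (1 - Real.cos (a * r)) = a ^ 2 / (t ^ 2 + a ^ 2) := by
  have hne : t ^ 2 + a ^ 2 ≠ 0 := by positivity
  have hd : ∀ r ∈ Ioi (0:ℝ), HasDerivAt (fun r => rexp (-(t * r)) *
      (-1 + (t ^ 2 * Real.cos (a * r) - t * a * Real.sin (a * r)) / (t ^ 2 + a ^ 2)))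
      (t * rexp (-(t * r)) * (1 - Real.cos (a * r))) r := by
    intro r _
    have h0 : ∀ c : ℝ, HasDerivAt (fun r : ℝ => c * r) c r := fun c => by
      simpa using (hasDerivAt_id r).const_mul c
    have h1 := (h0 t).neg.exp
    have h2 := (h0 a).cos
    have h3 := (h0 a).sin
    refine (h1.mul ((((h2.const_mul (t^2)).sub (h3.const_mul (t*a))).div_const
      (t^2+a^2)).const_add (-1))).congr_deriv ?_
    simp
    field_simp
    ring
  have hc : ContinuousWithinAt (fun r => rexp (-(t * r)) *
      (-1 + (t ^ 2 * Real.cos (a * r) - t * a * Real.sin (a * r)) / (t ^ 2 + a ^ 2))) (Ici 0) 0 := by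
    apply Continuous.continuousWithinAt
    fun_prop
  have hnn : ∀ r ∈ Ioi (0:ℝ), 0 ≤ t * rexp (-(t * r)) * (1 - Real.cos (a * r)) := by
    intro r _
    have := Real.cos_le_one (a * r)
    have : 0 ≤ 1 - Real.cos (a * r) := by linarith
    positivity
  have hlim : Tendsto (fun r => rexp (-(t * r)) *
      (-1 + (t ^ 2 * Real.cos (a * r) - t * a * Real.sin (a * r)) / (t ^ 2 + a ^ 2)))
      atTop (𝓝 0) := by
    refine Tendsto.zero_mul_isBoundedUnder_le
      (tendsto_exp_neg_atTop_nhds_zero.comp (tendsto_id.const_mul_atTop ht)) ?_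
    refine isBoundedUnder_of ⟨1 + (t ^ 2 + |t * a|) / (t ^ 2 + a ^ 2), fun r => ?_⟩
    simp only [Function.comp, Real.norm_eq_abs]
    refine (abs_add_le _ _).trans ?_
    rw [abs_neg, abs_one, abs_div, abs_of_pos (by positivity : 0 < t ^ 2 + a ^ 2)]
    gcongr
    refine (abs_sub _ _).trans ?_
    rw [abs_mul, abs_mul (t * a), abs_of_nonneg (sq_nonneg t)]
    nlinarith [Real.abs_cos_le_one (a * r), Real.abs_sin_le_one (a * r), abs_nonneg (t * a),
      sq_nonneg t]
  refine ⟨integrableOn_Ioi_deriv_of_nonneg hc hd hnn hlim, ?_⟩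
  rw [integral_Ioi_of_hasDerivAt_of_nonneg hc hd hnn hlim]
  simp
  field_simp
  ring

lemma integral_mul_exp_neg_mul {r : ℝ} (hr : 0 < r) :
    ∫ t in Ioi (0:ℝ), t * rexp (-(t * r)) = 1 / r ^ 2 := by
  have := Real.integral_rpow_mul_exp_neg_mul_Ioi (a := 2) (r := r) (by norm_num) hr
  simp only [Real.Gamma_two, mul_one] at this
  norm_num at this
  rw [← show (∫ t in Ioi (0:ℝ), t * rexp (-(r * t))) = 1 / r ^ 2 by simpa using this]
  simp_rw [mul_comm r]

lemma integral_sq_div_sq_add_sq (a : ℝ) :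
    IntegrableOn (fun t => a ^ 2 / (t ^ 2 + a ^ 2)) (Ioi 0) ∧
    ∫ t in Ioi (0:ℝ), a ^ 2 / (t ^ 2 + a ^ 2) = π / 2 * |a| := by
  rcases eq_or_ne a 0 with rfl | ha
  · simp
  have ha' : 0 < |a| := abs_pos.mpr ha
  have h : ∀ t : ℝ, a ^ 2 / (t ^ 2 + a ^ 2) = (1 + (|a|⁻¹ * t) ^ 2)⁻¹ := by
    intro t
    rw [mul_pow, inv_pow, sq_abs]
    field_simp
    ring
  simp_rw [h]
  refine ⟨?_, ?_⟩
  · exact (integrable_inv_one_add_sq.comp_mul_left' (inv_ne_zero ha'.ne')).integrableOn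
  · rw [integral_comp_mul_left_Ioi (fun t => (1 + t ^ 2)⁻¹) 0 (inv_pos.mpr ha')]
    simp [mul_comm]

lemma integral_one_sub_cos_div_sq (a : ℝ) :
    IntegrableOn (fun r => (1 - Real.cos (a * r)) / r ^ 2) (Ioi 0) ∧
    ∫ r in Ioi (0:ℝ), (1 - Real.cos (a * r)) / r ^ 2 = π / 2 * |a| := by
  set F : ℝ → ℝ → ℝ := fun t r => t * rexp (-(t * r)) * (1 - Real.cos (a * r)) with hF
  have hint : Integrable (Function.uncurry F)
      ((volume.restrict (Ioi 0)).prod (volume.restrict (Ioi 0))) := by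
    rw [integrable_prod_iff]
    · constructor
      · filter_upwards [ae_restrict_mem measurableSet_Ioi] with t ht
        exact (laplace_one_sub_cos a ht).1
      · refine (integral_sq_div_sq_add_sq a).1.congr ?_
        filter_upwards [ae_restrict_mem measurableSet_Ioi] with t ht
        rw [← (laplace_one_sub_cos a ht).2]
        refine integral_congr_ae (ae_of_all _ fun r => ?_)
        have := Real.cos_le_one (a * r)
        have : 0 ≤ 1 - Real.cos (a * r) := by linarith
        have ht' : 0 < t := ht
        simp only [Function.uncurry, hF]
        rw [Real.norm_of_nonneg (by positivity)]
    · apply Continuous.aestronglyMeasurable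
      simp only [hF, Function.uncurry_def]
      fun_prop
  have hae : ∀ᵐ r ∂(volume.restrict (Ioi (0:ℝ))),
      ∫ t in Ioi (0:ℝ), F t r = (1 - Real.cos (a * r)) / r ^ 2 := by
    filter_upwards [ae_restrict_mem measurableSet_Ioi] with r hr
    simp only [hF]
    rw [integral_mul_const, integral_mul_exp_neg_mul hr]
    ring
  refine ⟨hint.integral_prod_right.congr hae, ?_⟩
  rw [← integral_congr_ae hae, ← integral_integral_swap hint,
    ← (integral_sq_div_sq_add_sq a).2]
  exact setIntegral_congr_fun measurableSet_Ioi fun t ht => (laplace_one_sub_cos a ht).2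

lemma integrable_of_polarCoord {f : ℂ → ℝ}
    (h : IntegrableOn (fun p : ℝ × ℝ => p.1 • f (Complex.polarCoord.symm p)) polarCoord.target) :
    Integrable f := by
  rw [← (Complex.volume_preserving_equiv_real_prod.symm).integrable_comp_emb
    Complex.measurableEquivRealProd.symm.measurableEmbedding, ← integrableOn_univ,
    ← integrableOn_congr_set_ae polarCoord_source_ae_eq_univ,
    ← polarCoord.symm_image_target_eq_source,
    integrableOn_image_iff_integrableOn_abs_det_fderiv_smul volume
      polarCoord.open_target.measurableSet
      (fun p _ => (hasFDerivAt_polarCoord_symm p).hasFDerivWithinAt) polarCoord.symm.injOn]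
  refine h.congr_fun (fun p hp => ?_) polarCoord.open_target.measurableSet
  have hp1 : 0 < p.1 := hp.1
  simp only [det_fderivPolarCoordSymm, abs_of_pos hp1, Function.comp,
    Complex.measurableEquivRealProd_symm_polarCoord_symm_apply]

lemma integral_one_sub_cos_mul_arg {w : ℝ → ℝ} (hw : Continuous w) (b c : ℝ) :
    Integrable (fun z : ℂ =>
      (1 - Real.cos (2 * π * (b * z.re + c * z.im))) * (w z.arg / ‖z‖ ^ 3)) ∧
    ∫ z : ℂ, (1 - Real.cos (2 * π * (b * z.re + c * z.im))) * (w z.arg / ‖z‖ ^ 3)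
      = π ^ 2 * ∫ θ in (-π)..π, w θ * |b * Real.cos θ + c * Real.sin θ| := by
  set f : ℂ → ℝ := fun z =>
    (1 - Real.cos (2 * π * (b * z.re + c * z.im))) * (w z.arg / ‖z‖ ^ 3) with hf
  set A : ℝ → ℝ := fun θ => 2 * π * (b * Real.cos θ + c * Real.sin θ) with hA
  have hAc : Continuous A := by fun_prop
  set F : ℝ × ℝ → ℝ := fun p => (1 - Real.cos (A p.2 * p.1)) / p.1 ^ 2 * w p.2 with hF
  have hfF : Set.EqOn (fun p : ℝ × ℝ => p.1 • f (Complex.polarCoord.symm p)) F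
      polarCoord.target := by
    rintro ⟨r, θ⟩ ⟨hr, hθ⟩
    have hr' : 0 < r := hr
    simp only [hf, hF, smul_eq_mul, Complex.norm_polarCoord_symm, abs_of_pos hr']
    have harg : (Complex.polarCoord.symm (r, θ)).arg = θ := by
      rw [Complex.polarCoord_symm_apply]
      exact_mod_cast Complex.arg_mul_cos_add_sin_mul_I hr' ⟨hθ.1, hθ.2.le⟩
    rw [harg]
    have : 2 * π * (b * (Complex.polarCoord.symm (r, θ)).re
        + c * (Complex.polarCoord.symm (r, θ)).im) = A θ * r := by
      simp only [Complex.polarCoord_symm_apply, hA]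
      simp [Complex.cos_ofReal_re, Complex.sin_ofReal_re]
      ring
    rw [this]
    field_simp
  have htarget : polarCoord.target = Ioi (0:ℝ) ×ˢ Ioo (-π) π := rfl
  have hvol : (volume : Measure (ℝ × ℝ)).restrict polarCoord.target
      = (volume.restrict (Ioi (0:ℝ))).prod (volume.restrict (Ioo (-π) π)) := by
    rw [htarget, Measure.prod_restrict]; rfl
  have hcont : Continuous fun θ => π / 2 * |A θ| * w θ := by fun_prop
  have hint : IntegrableOn F polarCoord.target := by
    rw [IntegrableOn, hvol, integrable_prod_iff']
    · constructor
      · exact ae_of_all _ fun θ => (integral_one_sub_cos_div_sq (A θ)).1.mul_const (w θ)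
      · have : ∀ θ, ∫ r in Ioi (0:ℝ), ‖F (r, θ)‖ = ‖π / 2 * |A θ| * w θ‖ := by
          intro θ
          rw [← (integral_one_sub_cos_div_sq (A θ)).2, norm_mul, Real.norm_of_nonneg,
            ← integral_mul_const]
          · congr with r
            have := Real.cos_le_one (A θ * r)
            have : 0 ≤ 1 - Real.cos (A θ * r) := by linarith
            rw [norm_mul, Real.norm_of_nonneg (by positivity)]
          · refine integral_nonneg fun r => ?_
            have := Real.cos_le_one (A θ * r)
            have : 0 ≤ 1 - Real.cos (A θ * r) := by linarith
            positivity
        simp_rw [this]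
        exact (hcont.norm.integrableOn_Icc (a := -π) (b := π)).mono_set Ioo_subset_Icc_self
    · refine Measurable.aestronglyMeasurable ?_
      have := hw.measurable
      have := hAc.measurable
      fun_prop
  have htm := polarCoord.open_target.measurableSet
  refine ⟨integrable_of_polarCoord (hint.congr_fun hfF.symm htm), ?_⟩
  rw [← Complex.integral_comp_polarCoord_symm, setIntegral_congr_fun htm hfF, hvol,
    integral_prod_symm _ (by rw [← hvol]; exact hint),
    intervalIntegral.integral_of_le (by linarith [pi_pos]), integral_Ioc_eq_integral_Ioo,
    ← integral_const_mul]
  congr with θ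
  simp only [hF]
  rw [integral_mul_const, (integral_one_sub_cos_div_sq (A θ)).2]
  simp only [hA, abs_mul, abs_of_pos pi_pos, abs_two]
  ring

/-- The real-linear map `(y₁, y₂) ↦ y₁ / s + i y₂`. -/
def scaleRe (s : ℝ) : ℂ →ₗ[ℝ] ℂ where
  toFun z := ⟨z.re / s, z.im⟩
  map_add' z w := by apply Complex.ext <;> simp [add_div]
  map_smul' c z := by apply Complex.ext <;> simp [mul_div_assoc]

lemma det_scaleRe (s : ℝ) : LinearMap.det (scaleRe s) = s⁻¹ := by
  rw [← LinearMap.det_toMatrix Complex.basisOneI, Matrix.det_fin_two]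
  simp [LinearMap.toMatrix_apply, scaleRe]

lemma measurableEmbedding_scaleRe {s : ℝ} (hs : 0 < s) : MeasurableEmbedding (scaleRe s) := by
  refine (scaleRe s).continuous_of_finiteDimensional.measurableEmbedding ?_
  intro z w h
  have h1 := congrArg Complex.re h
  have h2 := congrArg Complex.im h
  simp only [scaleRe, LinearMap.coe_mk, AddHom.coe_mk] at h1 h2
  exact Complex.ext (by field_simp at h1; exact h1) h2

lemma map_scaleRe {s : ℝ} (hs : 0 < s) :
    Measure.map (scaleRe s) volume = ENNReal.ofReal s • (volume : Measure ℂ) := by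
  rw [Measure.map_linearMap_addHaar_eq_smul_addHaar volume
    (by rw [det_scaleRe]; positivity), det_scaleRe, inv_inv, abs_of_pos hs]

lemma integral_comp_scale {s : ℝ} (hs : 0 < s) {g : ℂ → ℝ} (hg : Integrable g) :
    Integrable (fun y : EuclideanSpace ℝ (Fin 2) =>
      g (((y 0 / s : ℝ) : ℂ) + ((y 1 : ℝ) : ℂ) * Complex.I)) ∧
    ∫ y : EuclideanSpace ℝ (Fin 2), g (((y 0 / s : ℝ) : ℂ) + ((y 1 : ℝ) : ℂ) * Complex.I)
      = s * ∫ z, g z := by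
  have hE : ∀ y : EuclideanSpace ℝ (Fin 2),
      (((y 0 / s : ℝ) : ℂ) + ((y 1 : ℝ) : ℂ) * Complex.I)
        = scaleRe s (Complex.orthonormalBasisOneI.repr.symm y) := by
    intro y
    apply Complex.ext <;> simp [scaleRe]
  have hmp := Complex.orthonormalBasisOneI.measurePreserving_repr_symm
  have hemb : MeasurableEmbedding (Complex.orthonormalBasisOneI.repr.symm) :=
    Complex.orthonormalBasisOneI.repr.symm.toHomeomorph.measurableEmbedding
  simp_rw [hE]
  constructor
  · refine (hmp.integrable_comp_emb hemb (g := fun z => g (scaleRe s z))).2 ?_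
    refine ((measurableEmbedding_scaleRe hs).integrable_map_iff (f := scaleRe s) (g := g)).1 ?_
    rw [map_scaleRe hs]
    exact hg.smul_measure ENNReal.ofReal_ne_top
  · rw [hmp.integral_comp hemb (fun z => g (scaleRe s z)),
      ← (measurableEmbedding_scaleRe hs).integral_map, map_scaleRe hs, integral_smul_measure,
      ENNReal.toReal_ofReal hs.le, smul_eq_mul]

/-- The quadratic form `β cos²θ + sin²θ`. -/
def angForm (β θ : ℝ) : ℝ := β * Real.cos θ ^ 2 + Real.sin θ ^ 2

/-- The derivative of `angForm β`. -/
def angFormDeriv (β θ : ℝ) : ℝ := 2 * (1 - β) * (Real.sin θ * Real.cos θ)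

lemma angForm_pos {β : ℝ} (hβ : 0 < β) (θ : ℝ) : 0 < angForm β θ := by
  have h := Real.sin_sq_add_cos_sq θ
  rcases eq_or_ne (Real.cos θ) 0 with h0 | h0
  · rw [angForm, h0]; rw [h0] at h; nlinarith
  · have : 0 < Real.cos θ ^ 2 := by positivity
    rw [angForm]; positivity

lemma hasDerivAt_angForm (β θ : ℝ) : HasDerivAt (angForm β) (angFormDeriv β θ) θ := by
  refine ((((hasDerivAt_cos θ).pow 2).const_mul β).add ((hasDerivAt_sin θ).pow 2)).congr_deriv ?_
  simp [angFormDeriv]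
  ring

lemma hasDerivAt_angFormDeriv (β θ : ℝ) :
    HasDerivAt (angFormDeriv β) (2 * (1 + β - 2 * angForm β θ)) θ := by
  refine (((hasDerivAt_sin θ).mul (hasDerivAt_cos θ)).const_mul (2 * (1 - β))).congr_deriv ?_
  simp only [angForm]
  linear_combination (2 + 2 * β) * Real.sin_sq_add_cos_sq θ

lemma angFormDeriv_sq (β θ : ℝ) :
    angFormDeriv β θ ^ 2 = 4 * (angForm β θ - β) * (1 - angForm β θ) := by
  have h := Real.sin_sq_add_cos_sq θ
  have h1 : angForm β θ - β = (1 - β) * Real.sin θ ^ 2 := by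
    simp only [angForm]; linear_combination β * h
  have h2 : 1 - angForm β θ = (1 - β) * Real.cos θ ^ 2 := by
    simp only [angForm]; linear_combination - h
  rw [mul_assoc, h1, h2, angFormDeriv]; ring

/-- The square root of `angForm β`. -/
def angRoot (β θ : ℝ) : ℝ := √(angForm β θ)

lemma angRoot_pos {β : ℝ} (hβ : 0 < β) (θ : ℝ) : 0 < angRoot β θ :=
  Real.sqrt_pos.2 (angForm_pos hβ θ)

lemma angRoot_sq {β : ℝ} (hβ : 0 < β) (θ : ℝ) : angRoot β θ ^ 2 = angForm β θ :=
  Real.sq_sqrt (angForm_pos hβ θ).le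

lemma hasDerivAt_angRoot {β : ℝ} (hβ : 0 < β) (θ : ℝ) :
    HasDerivAt (angRoot β) (angFormDeriv β θ / (2 * angRoot β θ)) θ :=
  (hasDerivAt_angForm β θ).sqrt (angForm_pos hβ θ).ne'

/-- The explicit `π`-periodic solution of `v'' + 9 v = f_β`. -/
def vExplicit (β θ : ℝ) : ℝ :=
  (6 * (1 + β) * angRoot β θ - 3 * β * (angRoot β θ)⁻¹ - 8 * angRoot β θ ^ 3) / (9 * β ^ 2)

/-- The derivative of `vExplicit β`. -/
def vExplicitDeriv (β θ : ℝ) : ℝ :=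
  (3 * (1 + β) * (angRoot β θ)⁻¹ + 3 / 2 * β * (angRoot β θ)⁻¹ ^ 3 - 12 * angRoot β θ)
    * angFormDeriv β θ / (9 * β ^ 2)

lemma hasDerivAt_vExplicit {β : ℝ} (hβ : 0 < β) (θ : ℝ) :
    HasDerivAt (vExplicit β) (vExplicitDeriv β θ) θ := by
  have hs := hasDerivAt_angRoot hβ θ
  have hp := angRoot_pos hβ θ
  refine ((((hs.const_mul (6 * (1 + β))).sub ((hs.inv hp.ne').const_mul (3 * β))).sub
    ((hs.pow 3).const_mul 8)).div_const (9 * β ^ 2)).congr_deriv ?_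
  simp only [vExplicitDeriv]
  field_simp
  simp
  left
  ring

lemma hasDerivAt_vExplicitDeriv {β : ℝ} (hβ : 0 < β) (θ : ℝ) :
    HasDerivAt (vExplicitDeriv β) (fker β θ - 9 * vExplicit β θ) θ := by
  have hs := hasDerivAt_angRoot hβ θ
  have hp := angRoot_pos hβ θ
  have hi := hs.inv hp.ne'
  have hf : fker β θ = (angRoot β θ ^ 5)⁻¹ := by
    rw [show fker β θ = angForm β θ ^ (-(5:ℝ) / 2) from rfl, angRoot, Real.sqrt_eq_rpow,
      ← Real.rpow_natCast, ← Real.rpow_mul (angForm_pos hβ θ).le,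
      ← Real.rpow_neg (angForm_pos hβ θ).le]
    norm_num
  refine ((((((hi.const_mul (3 * (1 + β))).add ((hi.pow 3).const_mul (3 / 2 * β))).sub
    (hs.const_mul 12)).mul (hasDerivAt_angFormDeriv β θ)).div_const (9 * β ^ 2))).congr_deriv ?_
  have hP := angFormDeriv_sq β θ
  rw [hf, ← angRoot_sq hβ]
  rw [← angRoot_sq hβ] at hP
  simp only [vExplicit, Pi.inv_apply, Pi.add_apply, Pi.sub_apply, Pi.pow_apply]
  simp
  generalize angRoot β θ = s at *
  generalize angFormDeriv β θ = P at *
  field_simp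
  ring_nf
  linear_combination -(9 * β + 6 * β * s ^ 2 + 6 * s ^ 2 + 24 * s ^ 4) * hP

lemma vExplicit_add_pi (β θ : ℝ) :
    vExplicit β (θ + π) = vExplicit β θ ∧ vExplicitDeriv β (θ + π) = vExplicitDeriv β θ := by
  simp [vExplicit, vExplicitDeriv, angRoot, angForm, angFormDeriv]

lemma IsVBeta.eq_vExplicit {β : ℝ} (hβ : 0 < β) {v : ℝ → ℝ} (hv : IsVBeta β v) :
    v = vExplicit β := by
  obtain ⟨hC, hper, hode⟩ := hv
  have hd1 : ∀ θ, HasDerivAt v (deriv v θ) θ := fun θ =>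
    (hC.differentiable (by norm_num) θ).hasDerivAt
  have hd2 : ∀ θ, HasDerivAt (deriv v) (deriv (deriv v) θ) θ := fun θ =>
    ((hC.deriv' (n := 1)).differentiable (by norm_num) θ).hasDerivAt
  have hper' : ∀ θ, deriv v (θ + π) = deriv v θ := fun θ => by
    rw [← deriv_comp_add_const]
    congr 1
    exact funext hper
  have h3 : ∀ θ : ℝ, HasDerivAt (fun θ : ℝ => 3 * θ) 3 θ := fun θ => by
    simpa using (hasDerivAt_id θ).const_mul 3
  have hshift : ∀ θ : ℝ, Real.cos (3 * (θ + π)) = -Real.cos (3 * θ) ∧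
      Real.sin (3 * (θ + π)) = -Real.sin (3 * θ) := fun θ => by
    have : 3 * (θ + π) = 3 * θ + π + 2 * π := by ring
    rw [this, Real.cos_add_two_pi, Real.sin_add_two_pi, Real.cos_add_pi, Real.sin_add_pi]
    exact ⟨rfl, rfl⟩
  set c₁ : ℝ → ℝ := fun θ => 3 * (v θ - vExplicit β θ) * Real.cos (3 * θ)
    - (deriv v θ - vExplicitDeriv β θ) * Real.sin (3 * θ) with hc₁
  set c₂ : ℝ → ℝ := fun θ => 3 * (v θ - vExplicit β θ) * Real.sin (3 * θ)
    + (deriv v θ - vExplicitDeriv β θ) * Real.cos (3 * θ) with hc₂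
  have hc₁d : ∀ θ, HasDerivAt c₁ 0 θ := fun θ => by
    refine (((((hd1 θ).sub (hasDerivAt_vExplicit hβ θ)).const_mul 3).mul (h3 θ).cos).sub
      (((hd2 θ).sub (hasDerivAt_vExplicitDeriv hβ θ)).mul (h3 θ).sin)).congr_deriv ?_
    simp only [Pi.sub_apply]
    linear_combination -Real.sin (3 * θ) * hode θ
  have hc₂d : ∀ θ, HasDerivAt c₂ 0 θ := fun θ => by
    refine (((((hd1 θ).sub (hasDerivAt_vExplicit hβ θ)).const_mul 3).mul (h3 θ).sin).add
      (((hd2 θ).sub (hasDerivAt_vExplicitDeriv hβ θ)).mul (h3 θ).cos)).congr_deriv ?_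
    simp only [Pi.sub_apply]
    linear_combination Real.cos (3 * θ) * hode θ
  have hz₁ : ∀ θ, c₁ θ = 0 := fun θ => by
    have h := is_const_of_deriv_eq_zero (fun θ => (hc₁d θ).differentiableAt)
      (fun θ => (hc₁d θ).deriv) (θ + π) θ
    have : c₁ (θ + π) = - c₁ θ := by
      simp only [hc₁, hper θ, hper' θ, vExplicit_add_pi β θ, hshift θ]; ring
    linarith
  have hz₂ : ∀ θ, c₂ θ = 0 := fun θ => by
    have h := is_const_of_deriv_eq_zero (fun θ => (hc₂d θ).differentiableAt)
      (fun θ => (hc₂d θ).deriv) (θ + π) θ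
    have : c₂ (θ + π) = - c₂ θ := by
      simp only [hc₂, hper θ, hper' θ, vExplicit_add_pi β θ, hshift θ]; ring
    linarith
  funext θ
  have e₁ := hz₁ θ
  have e₂ := hz₂ θ
  simp only [hc₁, hc₂] at e₁ e₂
  linear_combination (1 / 3) * Real.cos (3 * θ) * e₁ + (1 / 3) * Real.sin (3 * θ) * e₂
    - (v θ - vExplicit β θ) * Real.sin_sq_add_cos_sq (3 * θ)

lemma hasDerivAt_angRoot_pow_three {β : ℝ} (hβ : 0 < β) (θ : ℝ) :
    HasDerivAt (fun θ => angRoot β θ ^ 3) (3 / 2 * angRoot β θ * angFormDeriv β θ) θ := by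
  have hp := angRoot_pos hβ θ
  refine ((hasDerivAt_angRoot hβ θ).pow 3).congr_deriv ?_
  field_simp
  simp
  ring

lemma hasDerivAt_angRoot_pow_three_deriv {β : ℝ} (hβ : 0 < β) (θ : ℝ) :
    HasDerivAt (fun θ => 3 / 2 * angRoot β θ * angFormDeriv β θ)
      (9 * β ^ 2 * vExplicit β θ - angRoot β θ ^ 3) θ := by
  have hp := angRoot_pos hβ θ
  refine (((hasDerivAt_angRoot hβ θ).const_mul (3 / 2)).mul
    (hasDerivAt_angFormDeriv β θ)).congr_deriv ?_
  have hP := angFormDeriv_sq β θ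
  rw [← angRoot_sq hβ] at hP ⊢
  simp only [vExplicit]
  field_simp
  linear_combination (3 : ℝ) * hP

lemma continuous_vExplicit {β : ℝ} (hβ : 0 < β) : Continuous (vExplicit β) :=
  continuous_iff_continuousAt.2 fun θ => (hasDerivAt_vExplicit hβ θ).continuousAt

lemma integral_vExplicit_mul_cos {β : ℝ} (hβ : 0 < β) (φ : ℝ) :
    ∫ θ in (φ - π / 2)..(φ + π / 2), vExplicit β θ * Real.cos (θ - φ)
      = 2 / (9 * β ^ 2) * angRoot β (φ + π / 2) ^ 3 := by
  have hd : ∀ θ : ℝ, HasDerivAt (fun θ : ℝ => θ - φ) 1 θ := fun θ =>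
    (hasDerivAt_id θ).sub_const φ
  have hF : ∀ θ ∈ uIcc (φ - π / 2) (φ + π / 2), HasDerivAt (fun θ =>
      (3 / 2 * angRoot β θ * angFormDeriv β θ * Real.cos (θ - φ)
        + angRoot β θ ^ 3 * Real.sin (θ - φ)) / (9 * β ^ 2))
      (vExplicit β θ * Real.cos (θ - φ)) θ := fun θ _ => by
    refine ((((hasDerivAt_angRoot_pow_three_deriv hβ θ).mul (hd θ).cos).add
      ((hasDerivAt_angRoot_pow_three hβ θ).mul (hd θ).sin)).div_const _).congr_deriv ?_
    field_simp
    ring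
  have hc := continuous_vExplicit hβ
  rw [intervalIntegral.integral_eq_sub_of_hasDerivAt hF
    (Continuous.intervalIntegrable (by fun_prop) _ _)]
  have hs : angRoot β (φ - π / 2) = angRoot β (φ + π / 2) := by
    simp [angRoot, angForm, Real.cos_sub_pi_div_two, Real.sin_sub_pi_div_two,
      Real.cos_add_pi_div_two, Real.sin_add_pi_div_two]
  simp [hs]
  ring

lemma integral_vExplicit_mul_abs_cos {β : ℝ} (hβ : 0 < β) (φ : ℝ) :
    ∫ θ in (-π)..π, vExplicit β θ * |Real.cos (θ - φ)|
      = 4 / (9 * β ^ 2) * angRoot β (φ + π / 2) ^ 3 := by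
  have hc := continuous_vExplicit hβ
  have hper : Function.Periodic (fun θ => vExplicit β θ * |Real.cos (θ - φ)|) π := fun θ => by
    simp only [vExplicit_add_pi β θ, add_sub_right_comm, Real.cos_add_pi, abs_neg]
  have h1 := hper.intervalIntegral_add_zsmul_eq 2 (-π)
    (fun _ _ => Continuous.intervalIntegrable (by fun_prop) _ _)
  have h2 := hper.intervalIntegral_add_eq (-π) (φ - π / 2)
  have e1 : -π + (2:ℤ) • π = π := by simp; ring
  have e2 : φ - π / 2 + π = φ + π / 2 := by ring
  rw [e1, h2, e2] at h1
  rw [h1, ← show 2 * (2 / (9 * β ^ 2) * angRoot β (φ + π / 2) ^ 3)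
    = 4 / (9 * β ^ 2) * angRoot β (φ + π / 2) ^ 3 by ring, ← integral_vExplicit_mul_cos hβ φ]
  simp only [zsmul_eq_mul, Int.cast_ofNat]
  congr 1
  refine intervalIntegral.integral_congr fun θ hθ => ?_
  rw [uIcc_of_le (by linarith [pi_pos])] at hθ
  rw [abs_of_nonneg (Real.cos_nonneg_of_neg_pi_div_two_le_of_le (by linarith [hθ.1])
    (by linarith [hθ.2]))]

lemma integral_vExplicit_mul_abs_linear {β : ℝ} (hβ : 0 < β) (b c : ℝ) :
    √β * (9 * π ^ 2) * ∫ θ in (-π)..π, vExplicit β θ * |√β * b * Real.cos θ + c * Real.sin θ|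
      = 4 * π ^ 2 * (√(b ^ 2 + c ^ 2) ^ 3 / (β * b ^ 2 + c ^ 2)) := by
  set z : ℂ := ⟨√β * b, c⟩ with hz
  have hnorm : ‖z‖ ^ 2 = β * b ^ 2 + c ^ 2 := by
    rw [Complex.sq_norm, Complex.normSq_mk]
    linear_combination b ^ 2 * Real.mul_self_sqrt hβ.le
  rcases eq_or_ne z 0 with h0 | h0
  · have h1 : √β * b = 0 := congrArg Complex.re h0
    have h2 : c = 0 := congrArg Complex.im h0
    have h3 : b = 0 := (mul_eq_zero.1 h1).resolve_left (Real.sqrt_pos.2 hβ).ne'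
    simp [h2, h3]
  have hpos : 0 < ‖z‖ := norm_pos_iff.2 h0
  have hre : √β * b = ‖z‖ * Real.cos z.arg := (Complex.norm_mul_cos_arg z).symm
  have him : c = ‖z‖ * Real.sin z.arg := (Complex.norm_mul_sin_arg z).symm
  have hlin : ∀ θ, |√β * b * Real.cos θ + c * Real.sin θ| = ‖z‖ * |Real.cos (θ - z.arg)| := by
    intro θ
    have : ‖z‖ * |Real.cos (θ - z.arg)| = |‖z‖ * Real.cos (θ - z.arg)| := by
      rw [abs_mul, abs_of_pos hpos]
    rw [this, Real.cos_sub]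
    congr 1
    linear_combination Real.cos θ * hre + Real.sin θ * him
  have hroot : angRoot β (z.arg + π / 2) = √β * √(b ^ 2 + c ^ 2) / ‖z‖ := by
    have : angForm β (z.arg + π / 2) = β * (b ^ 2 + c ^ 2) / ‖z‖ ^ 2 := by
      rw [angForm, Real.cos_add_pi_div_two, Real.sin_add_pi_div_two, eq_div_iff (by positivity)]
      have hre2 : β * b ^ 2 = (‖z‖ * Real.cos z.arg) ^ 2 := by
        rw [← hre, mul_pow, Real.sq_sqrt hβ.le]
      linear_combination -hre2 - β * (c + ‖z‖ * Real.sin z.arg) * him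
    rw [angRoot, this, Real.sqrt_div' _ (sq_nonneg _), Real.sqrt_sq hpos.le,
      Real.sqrt_mul hβ.le]
  simp_rw [hlin]
  have hcomm : ∀ θ, vExplicit β θ * (‖z‖ * |Real.cos (θ - z.arg)|)
      = ‖z‖ * (vExplicit β θ * |Real.cos (θ - z.arg)|) := fun θ => by ring
  simp_rw [hcomm]
  rw [intervalIntegral.integral_const_mul, integral_vExplicit_mul_abs_cos hβ, hroot, ← hnorm]
  have hb : √β ^ 2 = β := Real.sq_sqrt hβ.le
  generalize √(b ^ 2 + c ^ 2) = t
  generalize ‖z‖ = n at *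
  have hb4 : √β ^ 4 = β ^ 2 := by
    linear_combination (√β ^ 2 + β) * hb
  field_simp
  linear_combination t ^ 3 * hb4

lemma inner_R2 (y ξ : R2) : ⟪y, ξ⟫ = y 0 * ξ 0 + y 1 * ξ 1 := by
  simp [PiLp.inner_apply, Fin.sum_univ_two, mul_comm]

lemma measurable_Kani (β : ℝ) {w : ℝ → ℝ} (hw : Continuous w) : Measurable (Kani β w) := by
  have h0 : Measurable fun y : R2 => y 0 := by fun_prop
  have h1 : Measurable fun y : R2 => y 1 := by fun_prop
  have harg : Measurable fun y : R2 =>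
      Complex.arg (((y 0 / Real.sqrt β : ℝ) : ℂ) + ((y 1 : ℝ) : ℂ) * Complex.I) := by
    refine Complex.measurable_arg.comp ?_
    fun_prop
  have hwm := hw.measurable.comp harg
  exact (hwm.const_mul 9).div
    ((((h0.pow_const 2).div_const β).add (h1.pow_const 2)).pow_const ((3:ℝ) / 2))

lemma abs_Kani {β : ℝ} (hβ : 0 < β) (w : ℝ → ℝ) (y : R2) :
    |Kani β w y| = Kani β (fun θ => |w θ|) y := by
  rw [Kani, Kani, abs_div, abs_mul, abs_of_pos (by norm_num : (0:ℝ) < 9),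
    abs_of_nonneg (by positivity : 0 ≤ ((y 0) ^ 2 / β + (y 1) ^ 2) ^ ((3:ℝ) / 2))]

lemma integral_one_sub_cos_mul_Kani {β : ℝ} (hβ : 0 < β) {w : ℝ → ℝ} (hw : Continuous w) (ξ : R2) :
    Integrable (fun y : R2 => (1 - Real.cos (2 * π * ⟪y, ξ⟫)) * Kani β w y) ∧
    ∫ y : R2, (1 - Real.cos (2 * π * ⟪y, ξ⟫)) * Kani β w y
      = √β * (9 * π ^ 2) *
        ∫ θ in (-π)..π, w θ * |√β * ξ 0 * Real.cos θ + ξ 1 * Real.sin θ| := by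
  have hs : 0 < √β := Real.sqrt_pos.2 hβ
  obtain ⟨h1, h2⟩ := integral_one_sub_cos_mul_arg hw (√β * ξ 0) (ξ 1)
  have key : ∀ y : R2, (1 - Real.cos (2 * π * ⟪y, ξ⟫)) * Kani β w y =
      9 * (fun z : ℂ => (1 - Real.cos (2 * π * (√β * ξ 0 * z.re + ξ 1 * z.im)))
        * (w z.arg / ‖z‖ ^ 3)) (((y 0 / √β : ℝ) : ℂ) + ((y 1 : ℝ) : ℂ) * Complex.I) := by
    intro y
    have hn : ((y 0) ^ 2 / β + (y 1) ^ 2) ^ ((3:ℝ) / 2)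
        = ‖((y 0 / √β : ℝ) : ℂ) + ((y 1 : ℝ) : ℂ) * Complex.I‖ ^ 3 := by
      rw [Complex.norm_add_mul_I, div_pow, Real.sq_sqrt hβ.le, Real.sqrt_eq_rpow,
        ← Real.rpow_mul_natCast (by positivity)]
      norm_num
    have hi : ⟪y, ξ⟫ = √β * ξ 0 * (y 0 / √β) + ξ 1 * y 1 := by
      rw [inner_R2]
      field_simp
    simp only [Kani, hn, hi]
    simp only [Complex.add_re, Complex.ofReal_re, Complex.mul_re, Complex.I_re, Complex.I_im,
      Complex.ofReal_im, Complex.add_im, Complex.mul_im, mul_zero, mul_one, sub_zero, add_zero,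
      zero_add]
    ring
  obtain ⟨h3, h4⟩ := integral_comp_scale hs h1
  simp_rw [key]
  refine ⟨h3.const_mul 9, ?_⟩
  rw [integral_const_mul, h4, h2]
  ring

lemma integral_mul_abs_linear_le {β : ℝ} {w : ℝ → ℝ} (hw : Continuous w) (hw0 : ∀ θ, 0 ≤ w θ)
    (ξ : R2) :
    ∫ θ in (-π)..π, w θ * |√β * ξ 0 * Real.cos θ + ξ 1 * Real.sin θ|
      ≤ ((√β + 1) * ∫ θ in (-π)..π, w θ) * ‖ξ‖ := by
  rw [mul_comm (√β + 1), mul_assoc, ← intervalIntegral.integral_mul_const]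
  refine intervalIntegral.integral_mono_on (by linarith [pi_pos])
    (Continuous.intervalIntegrable (by fun_prop) _ _)
    (Continuous.intervalIntegrable (by fun_prop) _ _) fun θ _ => ?_
  refine mul_le_mul_of_nonneg_left ?_ (hw0 θ)
  have e0 : |ξ 0| ≤ ‖ξ‖ := PiLp.norm_apply_le ξ 0
  have e1 : |ξ 1| ≤ ‖ξ‖ := PiLp.norm_apply_le ξ 1
  calc |√β * ξ 0 * Real.cos θ + ξ 1 * Real.sin θ|
      ≤ |√β * ξ 0 * Real.cos θ| + |ξ 1 * Real.sin θ| := abs_add_le _ _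
    _ = √β * |ξ 0| * |Real.cos θ| + |ξ 1| * |Real.sin θ| := by
      rw [abs_mul, abs_mul, abs_mul, abs_of_nonneg (Real.sqrt_nonneg β)]
    _ ≤ √β * ‖ξ‖ * 1 + ‖ξ‖ * 1 := by
      gcongr
      · exact Real.abs_cos_le_one θ
      · exact Real.abs_sin_le_one θ
    _ = (√β + 1) * ‖ξ‖ := by ring

/-- The complexification of a real Schwartz function. -/
def schwartzToComplex (u : SchwartzMap R2 ℝ) : SchwartzMap R2 ℂ :=
  u.postcompCLM (𝕜 := ℝ) Complex.ofRealCLM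

open scoped FourierTransform in
lemma FT_eq_fourier (u : SchwartzMap R2 ℝ) (ξ : R2) : FT u ξ = 𝓕 (schwartzToComplex u) ξ := by
  rw [SchwartzMap.fourier_coe, Real.fourier_eq', FT]
  congr with z
  rw [smul_eq_mul, neg_mul, neg_mul]
  rfl

lemma continuous_FT (u : SchwartzMap R2 ℝ) : Continuous (FT u) := by
  rw [funext (FT_eq_fourier u)]
  exact SchwartzMap.continuous _

lemma integrable_norm_pow_mul_FT (u : SchwartzMap R2 ℝ) (k : ℕ) :
    Integrable fun ξ : R2 => ‖ξ‖ ^ k * ‖FT u ξ‖ := by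
  simp_rw [FT_eq_fourier u]
  exact SchwartzMap.integrable_pow_mul volume _ k

lemma integrable_exp_mul_FT (u : SchwartzMap R2 ℝ) (x : R2) :
    Integrable fun ξ : R2 => Complex.exp (((2 * π * ⟪x, ξ⟫ : ℝ) : ℂ) * Complex.I) * FT u ξ := by
  have := continuous_FT u
  refine (integrable_norm_pow_mul_FT u 0).mono' (Continuous.aestronglyMeasurable (by fun_prop))
    (ae_of_all _ fun ξ => ?_)
  rw [norm_mul, Complex.norm_exp_ofReal_mul_I, pow_zero]

lemma integral_exp_mul_FT (u : SchwartzMap R2 ℝ) (x : R2) :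
    ∫ ξ : R2, Complex.exp (((2 * π * ⟪x, ξ⟫ : ℝ) : ℂ) * Complex.I) * FT u ξ = (u x : ℂ) := by
  have h : FourierTransformInv.fourierInv (FourierTransform.fourier (schwartzToComplex u))
      = schwartzToComplex u := FourierTransform.fourierInv_fourier_eq _
  have h' := DFunLike.congr_fun h x
  rw [SchwartzMap.fourierInv_coe, Real.fourierInv_eq'] at h'
  rw [show (u x : ℂ) = schwartzToComplex u x from rfl, ← h']
  congr with ξ
  rw [FT_eq_fourier, smul_eq_mul, real_inner_comm]

lemma multiplier_le {β : ℝ} (hβ : 1 / 2 ≤ β) (ξ : R2) :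
    ‖ξ‖ ^ 3 / (β * (ξ 0) ^ 2 + (ξ 1) ^ 2) ≤ 2 * ‖ξ‖ := by
  have hn : ‖ξ‖ ^ 2 = (ξ 0) ^ 2 + (ξ 1) ^ 2 := by
    rw [EuclideanSpace.norm_sq_eq, Fin.sum_univ_two]; simp
  refine div_le_of_le_mul₀ (by positivity) (by positivity) ?_
  have : ‖ξ‖ ^ 2 ≤ 2 * (β * (ξ 0) ^ 2 + (ξ 1) ^ 2) := by
    nlinarith [sq_nonneg (ξ 0), sq_nonneg (ξ 1)]
  nlinarith [norm_nonneg ξ]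

/-- the operator with Fourier multiplier `2π|ξ|³/(βξ₁²+ξ₂²)` has the
integral representation with anisotropic kernel `K`; both integrals converge absolutely. -/
theorem stmt9 (β : ℝ) (hβ : β ∈ Set.Icc (1/2 : ℝ) 2) (v : ℝ → ℝ) (hv : IsVBeta β v)
    (u : SchwartzMap R2 ℝ) (x : R2) :
    Integrable (fun ξ : R2 => Complex.exp (((2 * π * ⟪x, ξ⟫ : ℝ) : ℂ) * Complex.I)
        * ((2 * π * ‖ξ‖^3 / (β * (ξ 0)^2 + (ξ 1)^2) : ℝ) : ℂ) * FT (⇑u) ξ) ∧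
    Integrable (fun y : R2 => (u (x + y) + u (x - y) - 2 * u x) * Kani β v y) ∧
    (∫ ξ : R2, Complex.exp (((2 * π * ⟪x, ξ⟫ : ℝ) : ℂ) * Complex.I)
        * ((2 * π * ‖ξ‖^3 / (β * (ξ 0)^2 + (ξ 1)^2) : ℝ) : ℂ) * FT (⇑u) ξ)
      = (((-(1/(4*π))) * ∫ y : R2, (u (x + y) + u (x - y) - 2 * u x) * Kani β v y : ℝ) : ℂ) := by
  have hβ0 : 0 < β := by linarith [hβ.1]
  obtain rfl := hv.eq_vExplicit hβ0
  have hw := continuous_vExplicit hβ0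
  have hFT := continuous_FT u
  set G : R2 → R2 → ℂ := fun ξ y =>
    Complex.exp (((2 * π * ⟪x, ξ⟫ : ℝ) : ℂ) * Complex.I) * FT u ξ *
      ((-2 * ((1 - Real.cos (2 * π * ⟪y, ξ⟫)) * Kani β (vExplicit β) y) : ℝ) : ℂ) with hG
  have hnormG : ∀ ξ y, ‖G ξ y‖ = 2 * ‖FT u ξ‖ *
      ((1 - Real.cos (2 * π * ⟪y, ξ⟫)) * Kani β (fun θ => |vExplicit β θ|) y) := fun ξ y => by
    have : 0 ≤ 1 - Real.cos (2 * π * ⟪y, ξ⟫) := by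
      linarith [Real.cos_le_one (2 * π * ⟪y, ξ⟫)]
    rw [hG]
    simp only [norm_mul, Complex.norm_exp_ofReal_mul_I, Complex.norm_real, Real.norm_eq_abs,
      abs_of_nonneg this, abs_Kani hβ0]
    norm_num
    ring
  have hmeas : AEStronglyMeasurable (Function.uncurry G) (volume.prod volume) := by
    refine Measurable.aestronglyMeasurable ?_
    have hK := measurable_Kani β hw
    have hin : Measurable fun p : R2 × R2 => ⟪p.2, p.1⟫ := by fun_prop
    have := hFT.measurable
    simp only [hG, Function.uncurry_def]
    fun_prop
  have hint : Integrable (Function.uncurry G) (volume.prod volume) := by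
    rw [integrable_prod_iff hmeas]
    constructor
    · exact ae_of_all _ fun ξ =>
        (((integral_one_sub_cos_mul_Kani hβ0 hw ξ).1.const_mul (-2)).ofReal).const_mul
          (Complex.exp (((2 * π * ⟪x, ξ⟫ : ℝ) : ℂ) * Complex.I) * FT u ξ)
    · refine ((integrable_norm_pow_mul_FT u 1).const_mul
        (2 * (√β * (9 * π ^ 2) * ((√β + 1) * ∫ θ in (-π)..π, |vExplicit β θ|)))).mono'
        hmeas.norm.integral_prod_right' (ae_of_all _ fun ξ => ?_)
      rw [Real.norm_of_nonneg (integral_nonneg fun _ => norm_nonneg _)]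
      simp only [Function.uncurry, hnormG]
      rw [integral_const_mul, (integral_one_sub_cos_mul_Kani hβ0 hw.abs ξ).2]
      have := integral_mul_abs_linear_le (β := β) hw.abs (fun θ => abs_nonneg _) ξ
      calc _ ≤ 2 * ‖FT u ξ‖ * (√β * (9 * π ^ 2) *
            (((√β + 1) * ∫ θ in (-π)..π, |vExplicit β θ|) * ‖ξ‖)) := by gcongr
        _ = _ := by ring
  have hinner : ∀ y, ∫ ξ, G ξ y =
      (((u (x + y) + u (x - y) - 2 * u x) * Kani β (vExplicit β) y : ℝ) : ℂ) := fun y => by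
    have hsplit : ∀ ξ, G ξ y =
        (Complex.exp (((2 * π * ⟪x + y, ξ⟫ : ℝ) : ℂ) * Complex.I) * FT u ξ
        + Complex.exp (((2 * π * ⟪x - y, ξ⟫ : ℝ) : ℂ) * Complex.I) * FT u ξ
        - 2 * (Complex.exp (((2 * π * ⟪x, ξ⟫ : ℝ) : ℂ) * Complex.I) * FT u ξ))
          * (Kani β (vExplicit β) y : ℂ) := fun ξ => by
      have e1 : (((2 * π * ⟪x + y, ξ⟫ : ℝ) : ℂ) * Complex.I) =
          ((2 * π * ⟪x, ξ⟫ : ℝ) : ℂ) * Complex.I + ((2 * π * ⟪y, ξ⟫ : ℝ) : ℂ) * Complex.I := by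
        rw [inner_add_left]; push_cast; ring
      have e2 : (((2 * π * ⟪x - y, ξ⟫ : ℝ) : ℂ) * Complex.I) =
          ((2 * π * ⟪x, ξ⟫ : ℝ) : ℂ) * Complex.I + -((2 * π * ⟪y, ξ⟫ : ℝ) : ℂ) * Complex.I := by
        rw [inner_sub_left]; push_cast; ring
      have e3 := Complex.two_cos ((2 * π * ⟪y, ξ⟫ : ℝ) : ℂ)
      rw [e1, e2, Complex.exp_add, Complex.exp_add]
      simp only [hG]
      push_cast at e3 ⊢
      linear_combination Complex.exp (2 * π * ⟪x, ξ⟫ * Complex.I) * FT u ξ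
        * (Kani β (vExplicit β) y : ℂ) * e3
    simp_rw [hsplit]
    have i1 := integrable_exp_mul_FT u (x + y)
    have i2 := integrable_exp_mul_FT u (x - y)
    have i3 := (integrable_exp_mul_FT u x).const_mul 2
    have i12 : Integrable fun ξ : R2 =>
        Complex.exp (((2 * π * ⟪x + y, ξ⟫ : ℝ) : ℂ) * Complex.I) * FT u ξ
        + Complex.exp (((2 * π * ⟪x - y, ξ⟫ : ℝ) : ℂ) * Complex.I) * FT u ξ := i1.add i2
    rw [integral_mul_const, integral_sub i12 i3, integral_add i1 i2, integral_const_mul,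
      integral_exp_mul_FT, integral_exp_mul_FT, integral_exp_mul_FT]
    push_cast
    rfl
  have houter : ∀ ξ, ∫ y, G ξ y = (-(4 * π) : ℝ) *
      (Complex.exp (((2 * π * ⟪x, ξ⟫ : ℝ) : ℂ) * Complex.I)
        * ((2 * π * ‖ξ‖^3 / (β * (ξ 0)^2 + (ξ 1)^2) : ℝ) : ℂ) * FT (⇑u) ξ) := fun ξ => by
    have hn : √((ξ 0) ^ 2 + (ξ 1) ^ 2) = ‖ξ‖ := by
      rw [EuclideanSpace.norm_eq, Fin.sum_univ_two]; simp
    simp only [hG]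
    rw [integral_const_mul, integral_complex_ofReal, integral_const_mul,
      (integral_one_sub_cos_mul_Kani hβ0 hw ξ).2, integral_vExplicit_mul_abs_linear hβ0, hn]
    push_cast
    ring
  have hSK : Integrable (fun y : R2 => (u (x + y) + u (x - y) - 2 * u x)
      * Kani β (vExplicit β) y) := by
    have h := hint.integral_prod_right
    simp only [Function.uncurry, hinner] at h
    simpa using h.re
  refine ⟨?_, hSK, ?_⟩
  · refine ((integrable_norm_pow_mul_FT u 1).const_mul (2 * π * 2)).mono' ?_
      (ae_of_all _ fun ξ => ?_)
    · refine Measurable.aestronglyMeasurable ?_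
      have := hFT.measurable
      fun_prop
    · rw [norm_mul, norm_mul, Complex.norm_exp_ofReal_mul_I, Complex.norm_real,
        Real.norm_of_nonneg (by positivity), mul_div_assoc]
      have := multiplier_le hβ.1 ξ
      calc _ ≤ 1 * (2 * π * (2 * ‖ξ‖)) * ‖FT u ξ‖ := by gcongr
        _ = _ := by ring
  · have hswap := integral_integral_swap hint
    simp_rw [houter, hinner] at hswap
    rw [integral_const_mul, integral_complex_ofReal] at hswap
    rw [Complex.ofReal_mul, ← hswap, ← mul_assoc, ← Complex.ofReal_mul]
    have : -(1 / (4 * π)) * -(4 * π) = 1 := by field_simp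
    rw [this, Complex.ofReal_one, one_mul]
end
end

section
/- For every M > 0 there exists a constant C > 0, depending only on M, with the following property. Let u : ℝ² → ℝ be measurable with |u| ≤ M everywhere, and suppose u restricted to B₂ is Lipschitz with Lipschitz constant at most L₀, where L₀ ≥ 2. Then ∬_{D₁} |u(x) − u(y)|² / |x − y|³ dx dy ≤ C · log L₀ · (1 + ∫_{B₂} ‖Du(x)‖ dx), where Du denotes the (almost everywhere defined) derivative of u on B₂. In particular, for every β with 2/3 < β < 3/2, ℰ(u; B₁) ≤ C · log L₀ · (1 + ∫_{B₂} ‖Du(x)‖ dx), since K̄_β(x) ≤ 1/|x|³. -/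
open Real MeasureTheory Filter Topology Set
open scoped ENNReal NNReal RealInnerProductSpace

noncomputable section

/-- The anisotropic kernel `K̄(x) = 9 v(θ(x)) / |x|³`, with `θ(x)` a polar angle of `x`
(chosen as `Complex.arg`; the choice is immaterial since `v` is π-periodic). -/
def Kbar (v : ℝ → ℝ) (x : R2) : ℝ :=
  9 * v (Complex.arg ((x 0 : ℂ) + (x 1 : ℂ) * Complex.I)) / ‖x‖^3

/-- The nonlocal operator `L̄ g(x) = -(1/(4π)) ∫ (g(x+y)+g(x−y)−2g(x)) K̄(y) dy`. -/
def Lop (v : ℝ → ℝ) (g : R2 → ℝ) (x : R2) : ℝ :=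
  -(1/(4*π)) * ∫ y : R2, (g (x + y) + g (x - y) - 2 * g x) * Kbar v y

/-- `D_R = (ℝ²×ℝ²) \ (B_Rᶜ × B_Rᶜ)`. -/
def DR (R : ℝ) : Set (R2 × R2) := ((Metric.ball (0:R2) R)ᶜ ×ˢ (Metric.ball (0:R2) R)ᶜ)ᶜ

/-- The nonlocal energy `ℰ(u; B_R) = ∬_{D_R} |u(x)−u(y)|² K̄(x−y) dx dy`. -/
def nEnergy (v : ℝ → ℝ) (u : R2 → ℝ) (R : ℝ) : ℝ≥0∞ :=
  ∫⁻ p in DR R, ENNReal.ofReal (|u p.1 - u p.2|^2 * Kbar v (p.1 - p.2))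

section Kernel

theorem fker_nonneg {β : ℝ} (hβ : 0 ≤ β) (θ : ℝ) : 0 ≤ fker β θ := by
  unfold fker; positivity

theorem fker_le {β : ℝ} (h₁ : 2 / 3 < β) (θ : ℝ) : fker β θ ≤ (2 / 3 : ℝ) ^ (-(5 : ℝ) / 2) := by
  refine Real.rpow_le_rpow_of_nonpos (by norm_num) ?_ (by norm_num)
  nlinarith [Real.sin_sq_add_cos_sq θ, sq_nonneg (Real.sin θ), sq_nonneg (Real.cos θ)]

/-- A π-periodic solution of `v'' + 9 v = f` satisfies
`6 v(θ) = ∫_θ^{θ+π} f(s) sin (3 (s - θ)) ds`; in particular it is bounded by `π/6 · sup |f|`. -/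
theorem IsVBeta.abs_le {β : ℝ} {v : ℝ → ℝ} (hv : IsVBeta β v) {K : ℝ}
    (hK : ∀ θ, |fker β θ| ≤ K) (θ : ℝ) : |v θ| ≤ π / 6 * K := by
  obtain ⟨hC, hper, hode⟩ := hv
  have hd : ∀ s, HasDerivAt v (deriv v s) s := fun s =>
    ((hC.differentiable (by norm_num)) s).hasDerivAt
  have hC1 : ContDiff ℝ 1 (deriv v) := by
    have : ContDiff ℝ (1 + 1) v := by simpa [one_add_one_eq_two] using hC
    exact (contDiff_succ_iff_deriv.1 this).2.2
  have hdd : ∀ s, HasDerivAt (deriv v) (deriv (deriv v) s) s := fun s =>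
    ((hC1.differentiable (by norm_num)) s).hasDerivAt
  let W : ℝ → ℝ := fun s =>
    deriv v s * Real.sin (3 * (s - θ)) - 3 * v s * Real.cos (3 * (s - θ))
  have hW : ∀ s, HasDerivAt W (fker β s * Real.sin (3 * (s - θ))) s := by
    intro s
    have hl : HasDerivAt (fun s : ℝ => 3 * (s - θ)) 3 s := by
      simpa using ((hasDerivAt_id s).sub_const θ).const_mul 3
    have := ((hdd s).mul hl.sin).sub (((hd s).const_mul 3).mul hl.cos)
    refine this.congr_deriv ?_
    rw [← hode s]; ring
  have hbound := norm_image_sub_le_of_norm_deriv_le_segment' (f := W) (a := θ) (b := θ + π)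
    (C := K) (fun s _ => (hW s).hasDerivWithinAt) (fun s _ => by
      rw [norm_mul]
      have h1 := Real.abs_sin_le_one (3 * (s - θ))
      simp only [Real.norm_eq_abs]
      have := mul_le_mul (hK s) h1 (abs_nonneg _) ((abs_nonneg _).trans (hK s))
      simpa using this) (θ + π) (by simp [Real.pi_pos.le])
  have e1 : W (θ + π) = 3 * v θ := by
    have hs : Real.sin (3 * (θ + π - θ)) = 0 := by
      have := Real.sin_nat_mul_pi 3
      rw [show 3 * (θ + π - θ) = ((3 : ℕ) : ℝ) * π by push_cast; ring]
      exact this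
    have hc : Real.cos (3 * (θ + π - θ)) = -1 := by
      rw [show 3 * (θ + π - θ) = π + 2 * π by ring, Real.cos_add_two_pi, Real.cos_pi]
    simp only [W, hs, hc, hper θ]; ring
  have e2 : W θ = -(3 * v θ) := by simp [W]
  rw [e1, e2, Real.norm_eq_abs, show 3 * v θ - -(3 * v θ) = 6 * v θ by ring, abs_mul] at hbound
  norm_num at hbound
  linarith

end Kernel

section Translation

theorem enorm_sub_le_sum_range {E : Type*} [NormedAddCommGroup E] (f : ℕ → E) (n : ℕ) :
    ‖f n - f 0‖ₑ ≤ ∑ k ∈ Finset.range n, ‖f (k + 1) - f k‖ₑ := by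
  rw [← Finset.sum_range_sub]
  exact enorm_sum_le (Finset.range n) (fun k => f (k + 1) - f k)

theorem setLIntegral_ball_comp_add_le {E : Type*} [NormedAddCommGroup E] [MeasurableSpace E]
    [BorelSpace E] (μ : Measure E) [μ.IsAddRightInvariant] (g : E → ℝ≥0∞) {r s : ℝ} {c : E}
    (hc : r + ‖c‖ ≤ s) :
    ∫⁻ x in Metric.ball 0 r, g (x + c) ∂μ ≤ ∫⁻ x in Metric.ball 0 s, g x ∂μ := by
  rw [← lintegral_indicator Metric.isOpen_ball.measurableSet,
    ← lintegral_indicator Metric.isOpen_ball.measurableSet,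
    ← lintegral_add_right_eq_self ((Metric.ball (0 : E) s).indicator g) c]
  refine lintegral_mono fun x => ?_
  refine Set.indicator_le (g := fun x => (Metric.ball (0 : E) s).indicator g (x + c))
    (fun y hy => ?_) x
  rw [Set.indicator_of_mem]
  rw [mem_ball_zero_iff] at hy ⊢
  linarith [norm_add_le y c]

variable {E : Type*} [NormedAddCommGroup E] [NormedSpace ℝ E]
  [MeasurableSpace E] [BorelSpace E] (μ : Measure E) [μ.IsAddHaarMeasure]

/-- The `L¹` norm of `u(· + h) - u` is at most that of `n (u(· + h/n) - u)` on a larger ball. -/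
theorem setLIntegral_enorm_comp_add_sub_le_mul {u : E → ℝ} (hu : Measurable u) {r s : ℝ} {h : E}
    (hs : r + ‖h‖ ≤ s) {n : ℕ} (hn : n ≠ 0) :
    ∫⁻ x in Metric.ball 0 r, ‖u (x + h) - u x‖ₑ ∂μ
      ≤ n * ∫⁻ x in Metric.ball 0 s, ‖u (x + (n : ℝ)⁻¹ • h) - u x‖ₑ ∂μ := by
  have hn' : (n : ℝ) ≠ 0 := Nat.cast_ne_zero.2 hn
  calc ∫⁻ x in Metric.ball 0 r, ‖u (x + h) - u x‖ₑ ∂μ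
      ≤ ∫⁻ x in Metric.ball 0 r, ∑ k ∈ Finset.range n,
          ‖u (x + ((k : ℝ) / n) • h + (n : ℝ)⁻¹ • h) - u (x + ((k : ℝ) / n) • h)‖ₑ ∂μ := by
        refine lintegral_mono fun x => ?_
        have := enorm_sub_le_sum_range (fun k : ℕ => u (x + ((k : ℝ) / n) • h)) n
        simp only [div_self hn', one_smul, Nat.cast_zero, zero_div, zero_smul, add_zero] at this
        refine this.trans_eq (Finset.sum_congr rfl fun k _ => ?_)
        rw [add_assoc, ← add_smul]
        congr 5
        push_cast
        ring
    _ = ∑ k ∈ Finset.range n, ∫⁻ x in Metric.ball 0 r,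
          ‖u (x + ((k : ℝ) / n) • h + (n : ℝ)⁻¹ • h) - u (x + ((k : ℝ) / n) • h)‖ₑ ∂μ :=
        lintegral_finsetSum _ fun k _ => by fun_prop
    _ ≤ ∑ k ∈ Finset.range n,
          ∫⁻ x in Metric.ball 0 s, ‖u (x + (n : ℝ)⁻¹ • h) - u x‖ₑ ∂μ := by
        refine Finset.sum_le_sum fun k hk => ?_
        refine setLIntegral_ball_comp_add_le μ (fun x => ‖u (x + (n : ℝ)⁻¹ • h) - u x‖ₑ) ?_
        rw [norm_smul, Real.norm_of_nonneg (by positivity)]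
        have : (k : ℝ) / n ≤ 1 :=
          div_le_one_of_le₀ (by exact_mod_cast (Finset.mem_range.1 hk).le) (by positivity)
        nlinarith [norm_nonneg h]
    _ = _ := by simp

theorem setLIntegral_enorm_comp_add_sub_le [FiniteDimensional ℝ E] {u : E → ℝ} (hu : Measurable u) {L : ℝ≥0} {r R : ℝ}
    (hL : LipschitzOnWith L u (Metric.ball 0 R)) {h : E} (hh : r + 2 * ‖h‖ ≤ R) :
    ∫⁻ x in Metric.ball 0 r, ‖u (x + h) - u x‖ₑ ∂μ
      ≤ ‖h‖ₑ * ∫⁻ x in Metric.ball 0 R, ‖fderiv ℝ u x‖ₑ ∂μ := by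
  set s := r + ‖h‖ with hs
  have hsR : Metric.ball (0 : E) s ⊆ Metric.ball 0 R :=
    Metric.ball_subset_ball (by linarith [norm_nonneg h])
  have hsmall : ∀ n : ℕ, ‖((n + 1 : ℕ) : ℝ)⁻¹ • h‖ ≤ ‖h‖ := fun n => by
    rw [norm_smul, norm_inv, Real.norm_natCast]
    refine mul_le_of_le_one_left (norm_nonneg _) (inv_le_one_of_one_le₀ ?_)
    exact_mod_cast Nat.le_add_left 1 n
  have hmem : ∀ n : ℕ, ∀ x ∈ Metric.ball (0 : E) s,
      x + ((n + 1 : ℕ) : ℝ)⁻¹ • h ∈ Metric.ball (0 : E) R := fun n x hx => by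
    rw [mem_ball_zero_iff] at hx ⊢
    linarith [norm_add_le x (((n + 1 : ℕ) : ℝ)⁻¹ • h), hsmall n]
  have hlim : Tendsto (fun n : ℕ => ∫⁻ x in Metric.ball (0 : E) s,
      ((n + 1 : ℕ) : ℝ≥0∞) * ‖u (x + ((n + 1 : ℕ) : ℝ)⁻¹ • h) - u x‖ₑ ∂μ) atTop
      (𝓝 (∫⁻ x in Metric.ball (0 : E) s, ‖fderiv ℝ u x h‖ₑ ∂μ)) := by
    refine tendsto_lintegral_of_dominated_convergence (fun _ => (L : ℝ≥0∞) * ‖h‖ₑ) ?_ ?_ ?_ ?_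
    · intro n; fun_prop
    · intro n
      refine (ae_restrict_iff' Metric.isOpen_ball.measurableSet).2 (.of_forall fun x hx => ?_)
      have := hL.edist_le_mul_of_le (hmem n x hx) (hsR hx) le_rfl
      rw [edist_eq_enorm_sub, edist_eq_enorm_sub, add_sub_cancel_left, enorm_smul,
        enorm_inv (by positivity), Real.enorm_natCast] at this
      calc _ ≤ ((n + 1 : ℕ) : ℝ≥0∞) * (L * (((n + 1 : ℕ) : ℝ≥0∞)⁻¹ * ‖h‖ₑ)) :=
            mul_le_mul_right this _
        _ = (((n + 1 : ℕ) : ℝ≥0∞) * ((n + 1 : ℕ) : ℝ≥0∞)⁻¹) * (L * ‖h‖ₑ) := by ring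
        _ = L * ‖h‖ₑ := by
          rw [ENNReal.mul_inv_cancel (by positivity) (ENNReal.natCast_ne_top _), one_mul]
    · simp only [lintegral_const, Measure.restrict_apply_univ]
      exact ENNReal.mul_ne_top (ENNReal.mul_ne_top (by simp) (by simp))
        measure_ball_lt_top.ne
    · have hd := ae_restrict_of_ae (s := Metric.ball (0 : E) s)
        (hL.ae_differentiableWithinAt_of_mem (μ := μ))
      filter_upwards [hd, ae_restrict_mem Metric.isOpen_ball.measurableSet] with x hx hxs
      have hx' := ((hx (hsR hxs)).differentiableAt (Metric.isOpen_ball.mem_nhds (hsR hxs)))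
      have := hx'.hasFDerivAt.lim_real h |>.comp
        (tendsto_natCast_atTop_atTop.comp (tendsto_add_atTop_nat 1))
      refine this.enorm.congr fun n => ?_
      simp only [Function.comp_apply, smul_eq_mul, enorm_mul, Real.enorm_natCast]
  calc _ ≤ ∫⁻ x in Metric.ball (0 : E) s, ‖fderiv ℝ u x h‖ₑ ∂μ := by
        refine ge_of_tendsto' hlim fun n => ?_
        rw [lintegral_const_mul _ (by fun_prop)]
        exact setLIntegral_enorm_comp_add_sub_le_mul μ hu le_rfl n.succ_ne_zero
    _ ≤ ∫⁻ x in Metric.ball (0 : E) s, ‖h‖ₑ * ‖fderiv ℝ u x‖ₑ ∂μ := by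
        refine lintegral_mono fun x => ?_
        rw [mul_comm]
        exact ContinuousLinearMap.le_opENorm _ _
    _ ≤ ∫⁻ x in Metric.ball (0 : E) R, ‖h‖ₑ * ‖fderiv ℝ u x‖ₑ ∂μ := lintegral_mono_set hsR
    _ = _ := lintegral_const_mul _ (measurable_fderiv ℝ u).enorm

end Translation

section Radial

/-- Integration in polar coordinates in the plane. -/
theorem setLIntegral_ofReal_fun_norm {g : ℝ → ℝ} {s : Set ℝ} (hs : MeasurableSet s)
    (hs0 : s ⊆ Ioi 0) (hg : ∀ r ∈ s, 0 ≤ g r) (hint : IntegrableOn (fun r => r * g r) s) :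
    ∫⁻ x : R2 in {x | ‖x‖ ∈ s}, ENNReal.ofReal (g ‖x‖)
      = ENNReal.ofReal (2 * volume.real (Metric.ball (0 : R2) 1) * ∫ r in s, r * g r) := by
  have hf0 : ∀ r, 0 ≤ s.indicator g r := fun r => Set.indicator_nonneg hg r
  have hmul : (fun r : ℝ => r ^ (Module.finrank ℝ R2 - 1) • s.indicator g r)
      = s.indicator fun r => r * g r := by
    funext r
    by_cases hr : r ∈ s <;> simp [hr]
  have hsub : Ioi 0 ∩ s = s := inter_eq_self_of_subset_right hs0
  have hI : Integrable (fun x : R2 => s.indicator g ‖x‖) := by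
    rw [integrable_fun_norm_addHaar (volume : Measure R2) (f := s.indicator g), hmul]
    exact ((integrable_indicator_iff hs).2 hint).integrableOn
  have hm : MeasurableSet {x : R2 | ‖x‖ ∈ s} := measurable_norm hs
  rw [← lintegral_indicator hm]
  calc _ = ∫⁻ x : R2, ENNReal.ofReal (s.indicator g ‖x‖) := by
        refine lintegral_congr fun x => ?_
        by_cases hx : ‖x‖ ∈ s <;> simp [hx]
    _ = ENNReal.ofReal (∫ x : R2, s.indicator g ‖x‖) :=
        (ofReal_integral_eq_lintegral_ofReal hI (.of_forall fun _ => hf0 _)).symm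
    _ = _ := by
        rw [integral_fun_norm_addHaar (volume : Measure R2) (s.indicator g), hmul,
          setIntegral_indicator hs, hsub]
        simp [mul_assoc]

theorem setLIntegral_norm_mem_Ioc_zero {a c : ℝ} (ha : 0 ≤ a) (hc : 0 ≤ c) :
    ∫⁻ x : R2 in {x | ‖x‖ ∈ Ioc 0 a}, ENNReal.ofReal (c / ‖x‖)
      = ENNReal.ofReal (2 * volume.real (Metric.ball (0 : R2) 1) * (c * a)) := by
  have h : EqOn (fun r : ℝ => r * (c / r)) (fun _ => c) (Ioc 0 a) := fun r hr => by
    have := hr.1.ne'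
    simp only
    field_simp
  rw [setLIntegral_ofReal_fun_norm (g := fun r => c / r) measurableSet_Ioc (fun r hr => hr.1)
    (fun r hr => div_nonneg hc hr.1.le), setIntegral_congr_fun measurableSet_Ioc h]
  · simp [ha, mul_comm]
  · exact (integrableOn_congr_fun h measurableSet_Ioc).2 (by simp)

theorem setLIntegral_norm_mem_Ioc {a b c : ℝ} (ha : 0 < a) (hab : a ≤ b) (hc : 0 ≤ c) :
    ∫⁻ x : R2 in {x | ‖x‖ ∈ Ioc a b}, ENNReal.ofReal (c / ‖x‖ ^ 2)
      = ENNReal.ofReal (2 * volume.real (Metric.ball (0 : R2) 1) * (c * Real.log (b / a))) := by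
  have h : EqOn (fun r : ℝ => r * (c / r ^ 2)) (fun r => c * r⁻¹) (Ioc a b) := fun r hr => by
    have := (ha.trans hr.1).ne'
    simp only
    field_simp
  rw [setLIntegral_ofReal_fun_norm (g := fun r => c / r ^ 2) measurableSet_Ioc
    (fun r hr => ha.trans hr.1) (fun r hr => by positivity),
    setIntegral_congr_fun measurableSet_Ioc h, ← intervalIntegral.integral_of_le hab,
    intervalIntegral.integral_const_mul, integral_inv_of_pos ha (ha.trans_le hab)]
  refine (integrableOn_congr_fun h measurableSet_Ioc).2 ?_
  rw [← intervalIntegrable_iff_integrableOn_Ioc_of_le hab]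
  refine (intervalIntegral.intervalIntegrable_inv (fun x hx => ?_) continuousOn_id).const_mul c
  rw [uIcc_of_le hab] at hx
  exact (ha.trans_le hx.1).ne'

theorem setLIntegral_norm_mem_Ioi {b c : ℝ} (hb : 0 < b) (hc : 0 ≤ c) :
    ∫⁻ x : R2 in {x | ‖x‖ ∈ Ioi b}, ENNReal.ofReal (c / ‖x‖ ^ 3)
      = ENNReal.ofReal (2 * volume.real (Metric.ball (0 : R2) 1) * (c / b)) := by
  have h : EqOn (fun r : ℝ => r * (c / r ^ 3)) (fun r => c * r ^ (-2 : ℝ)) (Ioi b) := fun r hr => by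
    have hr0 : 0 < r := hb.trans hr
    simp only
    rw [Real.rpow_neg hr0.le, Real.rpow_two]
    field_simp
  rw [setLIntegral_ofReal_fun_norm (g := fun r => c / r ^ 3) measurableSet_Ioi
    (fun r hr => hb.trans hr) (fun r hr => by have : 0 < r := hb.trans hr; positivity),
    setIntegral_congr_fun measurableSet_Ioi h, integral_const_mul,
    integral_Ioi_rpow_of_lt (by norm_num) hb]
  · norm_num [Real.rpow_neg_one, div_eq_mul_inv]
  · exact (integrableOn_congr_fun h measurableSet_Ioi).2
      ((integrableOn_Ioi_rpow_of_lt (by norm_num) hb).const_mul c)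

end Radial

section Energy

/-- The integral of a nonnegative function over `D_R`, invariant under exchanging the variables,
is at most twice its integral over `B_R × ℝ²`, written in the variables `x` and `h = y - x`. -/
theorem setLIntegral_DR_le {F : R2 → R2 → ℝ≥0∞} (hF : Measurable (Function.uncurry F))
    (hsymm : ∀ x y, F x y = F y x) (R : ℝ) :
    ∫⁻ p in DR R, F p.1 p.2 ≤ 2 * ∫⁻ h, ∫⁻ x in Metric.ball 0 R, F x (x + h) := by
  have hF₀ : Measurable fun p : R2 × R2 => F p.1 p.2 := hF
  have hsub : DR R ⊆ (Metric.ball (0 : R2) R ×ˢ univ) ∪ (univ ×ˢ Metric.ball (0 : R2) R) := by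
    rintro ⟨x, y⟩ hp
    simp only [DR, mem_compl_iff, mem_prod, not_and_or, not_not] at hp
    simpa using hp
  have h₁ : ∫⁻ p in Metric.ball (0 : R2) R ×ˢ (univ : Set R2), F p.1 p.2
      = ∫⁻ h, ∫⁻ x in Metric.ball 0 R, F x (x + h) := by
    have hF' : Measurable fun p : R2 × R2 => F p.1 (p.1 + p.2) :=
      hF.comp (measurable_fst.prodMk (measurable_fst.add measurable_snd))
    rw [Measure.volume_eq_prod, setLIntegral_prod _ hF₀.aemeasurable, Measure.restrict_univ,
      lintegral_lintegral_swap (f := fun h x => F x (x + h))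
        (hF'.comp measurable_swap).aemeasurable]
    exact lintegral_congr fun x => (lintegral_add_left_eq_self (fun y => F x y) x).symm
  have h₂ : ∫⁻ p in (univ : Set R2) ×ˢ Metric.ball (0 : R2) R, F p.1 p.2
      = ∫⁻ p in Metric.ball (0 : R2) R ×ˢ (univ : Set R2), F p.1 p.2 := by
    rw [Measure.volume_eq_prod, setLIntegral_prod_symm _ hF₀.aemeasurable,
      setLIntegral_prod _ hF₀.aemeasurable]
    exact lintegral_congr fun x => lintegral_congr fun y => hsymm y x
  calc _ ≤ _ := lintegral_mono_set hsub
    _ ≤ _ := lintegral_union_le _ _ _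
    _ = _ := by rw [h₂, h₁, two_mul]

theorem lintegral_le_norm_shells (J : R2 → ℝ≥0∞) (a b : ℝ) :
    ∫⁻ h, J h ≤ (∫⁻ h in {h | ‖h‖ ∈ Ioc 0 a}, J h) + (∫⁻ h in {h | ‖h‖ ∈ Ioc a b}, J h)
      + ∫⁻ h in {h | ‖h‖ ∈ Ioi b}, J h := by
  have hsub : ({0}ᶜ : Set R2) ⊆
      ({h | ‖h‖ ∈ Ioc 0 a} ∪ {h | ‖h‖ ∈ Ioc a b}) ∪ {h | ‖h‖ ∈ Ioi b} := by
    intro h hh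
    have : 0 < ‖h‖ := norm_pos_iff.2 hh
    simp only [mem_union, mem_ofPred_eq, mem_Ioc, mem_Ioi]
    grind
  calc ∫⁻ h, J h = ∫⁻ h in {0}ᶜ, J h := by rw [restrict_compl_singleton]
    _ ≤ _ := lintegral_mono_set hsub
    _ ≤ _ := lintegral_union_le _ _ _
    _ ≤ _ := by gcongr; exact lintegral_union_le _ _ _

theorem setLIntegral_ofReal_sq_div_le {u : R2 → ℝ} (hu : Measurable u) {L : ℝ≥0}
    (hL : LipschitzOnWith L u (Metric.ball 0 2)) {h : R2} (hh : ‖h‖ ≤ 1 / 2) {c : ℝ} (hc : 0 ≤ c)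
    (hc' : ∀ x ∈ Metric.ball (0 : R2) 1, |u x - u (x + h)| ≤ c) :
    ∫⁻ x in Metric.ball 0 1, ENNReal.ofReal (|u x - u (x + h)| ^ 2 / ‖x - (x + h)‖ ^ 3)
      ≤ ENNReal.ofReal
        (c / ‖h‖ ^ 2 * ∫ x in Metric.ball (0 : R2) 2, ‖fderiv ℝ u x‖) := by
  have hint : IntegrableOn (fderiv ℝ u) (Metric.ball (0 : R2) 2) :=
    Measure.integrableOn_of_bounded (M := L) measure_ball_lt_top.ne
      (measurable_fderiv ℝ u).aestronglyMeasurable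
      ((ae_restrict_iff' Metric.isOpen_ball.measurableSet).2 (.of_forall fun x hx =>
        norm_fderiv_le_of_lipschitzOn ℝ (Metric.isOpen_ball.mem_nhds hx) hL))
  rcases eq_or_ne h 0 with rfl | h0
  · simp
  have hpos : 0 < ‖h‖ := norm_pos_iff.2 h0
  calc _ ≤ ∫⁻ x in Metric.ball (0 : R2) 1, ENNReal.ofReal (c / ‖h‖ ^ 3) * ‖u (x + h) - u x‖ₑ := by
        refine setLIntegral_mono (by fun_prop) fun x hx => ?_
        rw [← ofReal_norm, ← ENNReal.ofReal_mul (by positivity), Real.norm_eq_abs,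
          abs_sub_comm (u (x + h)), sub_add_cancel_left, norm_neg, div_mul_eq_mul_div, sq]
        have := hc' x hx
        gcongr
    _ = ENNReal.ofReal (c / ‖h‖ ^ 3) * ∫⁻ x in Metric.ball (0 : R2) 1, ‖u (x + h) - u x‖ₑ :=
        lintegral_const_mul _ (by fun_prop)
    _ ≤ ENNReal.ofReal (c / ‖h‖ ^ 3) *
          (‖h‖ₑ * ∫⁻ x in Metric.ball (0 : R2) 2, ‖fderiv ℝ u x‖ₑ) := by
        gcongr
        exact setLIntegral_enorm_comp_add_sub_le volume hu hL (by linarith)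
    _ = _ := by
        rw [← ofReal_integral_norm_eq_lintegral_enorm hint, ← ofReal_norm,
          ← ENNReal.ofReal_mul (by positivity), ← ENNReal.ofReal_mul (by positivity)]
        congr 1
        field_simp

theorem setLIntegral_DR_sq_div_le {M : ℝ} {u : R2 → ℝ} (hu : Measurable u)
    (huM : ∀ x, |u x| ≤ M) {L : ℝ≥0} (hL2 : 2 ≤ (L : ℝ))
    (hL : LipschitzOnWith L u (Metric.ball 0 2)) :
    ∫⁻ p in DR 1, ENNReal.ofReal (|u p.1 - u p.2| ^ 2 / ‖p.1 - p.2‖ ^ 3)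
      ≤ ENNReal.ofReal (4 * volume.real (Metric.ball (0 : R2) 1) *
          ((1 + 2 * M * Real.log (L / 2)) * (∫ x in Metric.ball (0 : R2) 2, ‖fderiv ℝ u x‖)
            + 8 * M ^ 2 * volume.real (Metric.ball (0 : R2) 1))) := by
  set V := volume.real (Metric.ball (0 : R2) 1) with hV
  set I := ∫ x in Metric.ball (0 : R2) 2, ‖fderiv ℝ u x‖ with hI
  have hV0 : 0 ≤ V := measureReal_nonneg
  have hI0 : 0 ≤ I := integral_nonneg fun _ => norm_nonneg _
  have hM : 0 ≤ M := (abs_nonneg _).trans (huM 0)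
  have hLpos : (0 : ℝ) < L := by linarith
  have hLinv : (L : ℝ)⁻¹ ≤ 1 / 2 := by
    rw [one_div]; exact inv_anti₀ (by norm_num) hL2
  have hlog : 0 ≤ Real.log (L / 2) := Real.log_nonneg (by linarith)
  have hdiff : ∀ x y, |u x - u y| ≤ 2 * M := fun x y => by
    linarith [abs_sub (u x) (u y), huM x, huM y]
  set J : R2 → ℝ≥0∞ := fun h => ∫⁻ x in Metric.ball (0 : R2) 1,
    ENNReal.ofReal (|u x - u (x + h)| ^ 2 / ‖x - (x + h)‖ ^ 3) with hJ
  have near : ∫⁻ h in {h | ‖h‖ ∈ Ioc 0 (L : ℝ)⁻¹}, J h ≤ ENNReal.ofReal (2 * V * I) := by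
    calc _ ≤ ∫⁻ h : R2 in {h | ‖h‖ ∈ Ioc 0 (L : ℝ)⁻¹}, ENNReal.ofReal (L * I / ‖h‖) := by
          refine setLIntegral_mono (by fun_prop) fun h hh => ?_
          have h1 : ‖h‖ ≤ 1 / 2 := hh.2.trans hLinv
          have hpos : 0 < ‖h‖ := hh.1
          refine (setLIntegral_ofReal_sq_div_le hu hL h1 (c := L * ‖h‖) (by positivity)
            fun x hx => ?_).trans_eq ?_
          · rw [mem_ball_zero_iff] at hx
            have := hL.norm_sub_le (x := x) (y := x + h) (mem_ball_zero_iff.2 (by linarith))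
              (mem_ball_zero_iff.2 (by linarith [norm_add_le x h]))
            simpa using this
          · rw [← hI]
            congr 1
            field_simp
      _ = _ := by
          rw [setLIntegral_norm_mem_Ioc_zero (by positivity) (by positivity), ← hV]
          congr 1
          field_simp
  have mid : ∫⁻ h in {h | ‖h‖ ∈ Ioc (L : ℝ)⁻¹ (1 / 2)}, J h
      ≤ ENNReal.ofReal (2 * V * (2 * M * I * Real.log (L / 2))) := by
    calc _ ≤ ∫⁻ h : R2 in {h | ‖h‖ ∈ Ioc (L : ℝ)⁻¹ (1 / 2)},
            ENNReal.ofReal (2 * M * I / ‖h‖ ^ 2) := by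
          refine setLIntegral_mono (by fun_prop) fun h hh => ?_
          refine (setLIntegral_ofReal_sq_div_le hu hL hh.2 (c := 2 * M) (by positivity)
            fun x _ => hdiff _ _).trans_eq ?_
          congr 1
          ring
      _ = _ := by
          rw [setLIntegral_norm_mem_Ioc (by positivity) hLinv (by positivity)]
          congr 4
          field_simp
  have far : ∫⁻ h in {h | ‖h‖ ∈ Ioi (1 / 2)}, J h ≤ ENNReal.ofReal (2 * V * (8 * M ^ 2 * V)) := by
    calc _ ≤ ∫⁻ h : R2 in {h | ‖h‖ ∈ Ioi (1 / 2)},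
            ENNReal.ofReal (4 * M ^ 2 * V / ‖h‖ ^ 3) := by
          refine setLIntegral_mono (by fun_prop) fun h _ => ?_
          calc J h ≤ ∫⁻ x in Metric.ball (0 : R2) 1, ENNReal.ofReal ((2 * M) ^ 2 / ‖h‖ ^ 3) := by
                refine lintegral_mono fun x => ?_
                rw [sub_add_cancel_left, norm_neg]
                have := hdiff x (x + h)
                gcongr
            _ = _ := by
                rw [lintegral_const, Measure.restrict_apply_univ,
                  ← ofReal_measureReal measure_ball_lt_top.ne,
                  ← ENNReal.ofReal_mul (by positivity)]
                congr 1
                rw [← hV]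
                ring
      _ = _ := by
          rw [setLIntegral_norm_mem_Ioi (by norm_num) (by positivity)]
          congr 1
          ring
  calc _ ≤ 2 * ∫⁻ h, J h := by
        refine setLIntegral_DR_le
          (F := fun x y => ENNReal.ofReal (|u x - u y| ^ 2 / ‖x - y‖ ^ 3)) ?_ ?_ 1
        · simp only [Function.uncurry_def]
          fun_prop
        · intro x y
          rw [abs_sub_comm, norm_sub_rev]
    _ ≤ 2 * (ENNReal.ofReal (2 * V * I) + ENNReal.ofReal (2 * V * (2 * M * I * Real.log (L / 2)))
          + ENNReal.ofReal (2 * V * (8 * M ^ 2 * V))) := by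
        gcongr
        exact (lintegral_le_norm_shells J _ _).trans (add_le_add (add_le_add near mid) far)
    _ = _ := by
        rw [← ENNReal.ofReal_add (by positivity) (by positivity),
          ← ENNReal.ofReal_add (by positivity) (by positivity), ← ENNReal.ofReal_ofNat,
          ← ENNReal.ofReal_mul (by norm_num)]
        congr 1
        ring

theorem nEnergy_le_mul {v : ℝ → ℝ} {K : ℝ} (hK : 0 ≤ K) (hv : ∀ θ, 9 * v θ ≤ K)
    (u : R2 → ℝ) (R : ℝ) :
    nEnergy v u R ≤ ENNReal.ofReal K *
      ∫⁻ p in DR R, ENNReal.ofReal (|u p.1 - u p.2| ^ 2 / ‖p.1 - p.2‖ ^ 3) := by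
  rw [nEnergy, ← lintegral_const_mul' _ _ ENNReal.ofReal_ne_top]
  refine lintegral_mono fun p => ?_
  rw [← ENNReal.ofReal_mul hK, Kbar, mul_div_assoc', mul_div_assoc']
  have := hv (Complex.arg (((p.1 - p.2) 0 : ℂ) + ((p.1 - p.2) 1 : ℂ) * Complex.I))
  refine ENNReal.ofReal_le_ofReal ?_
  rw [mul_comm K]
  gcongr

end Energy

/-- sharp interpolation inequality. For a bounded measurable `u` with
`|u| ≤ M` which is Lipschitz on `B₂` with constant `L₀ ≥ 2`,
`∬_{D₁} |u(x)−u(y)|²/|x−y|³ ≤ C log L₀ (1 + ∫_{B₂} ‖Du‖)`, with `C = C(M)`; in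
particular the same bound holds for `ℰ(u; B₁)` when `2/3 < β < 3/2`, since
`K̄_β(x) ≤ 1/|x|³`. -/
theorem stmt14 (M : ℝ) (hM : 0 < M) :
    ∃ C > (0:ℝ), ∀ u : R2 → ℝ, Measurable u → (∀ x, |u x| ≤ M) →
      ∀ L₀ : ℝ≥0, 2 ≤ (L₀ : ℝ) → LipschitzOnWith L₀ u (Metric.ball (0:R2) 2) →
        (∫⁻ p in DR 1, ENNReal.ofReal (|u p.1 - u p.2|^2 / ‖p.1 - p.2‖^3))
          ≤ ENNReal.ofReal (C * Real.log L₀ *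
              (1 + ∫ x in Metric.ball (0:R2) 2, ‖fderiv ℝ u x‖)) ∧
        ∀ β : ℝ, 2/3 < β → β < 3/2 → ∀ v : ℝ → ℝ, IsVBeta β v →
          nEnergy v u 1
            ≤ ENNReal.ofReal (C * Real.log L₀ *
                (1 + ∫ x in Metric.ball (0:R2) 2, ‖fderiv ℝ u x‖)) := by
  set V := volume.real (Metric.ball (0 : R2) 1) with hV
  have hV0 : 0 ≤ V := measureReal_nonneg
  set K : ℝ := 9 * (π / 6 * (2 / 3 : ℝ) ^ (-(5 : ℝ) / 2)) with hK
  have hK0 : 0 ≤ K := by positivity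
  set C₀ : ℝ := 4 * V * (2 + 2 * M + 16 * M ^ 2 * V) with hC₀
  have hC₀0 : 0 ≤ C₀ := by positivity
  refine ⟨(1 + K) * C₀ + 1, by positivity, fun u hu huM L₀ hL2 hL => ?_⟩
  set I := ∫ x in Metric.ball (0 : R2) 2, ‖fderiv ℝ u x‖ with hI
  have hI0 : 0 ≤ I := integral_nonneg fun _ => norm_nonneg _
  have hlog2 : 1 / 2 ≤ Real.log L₀ := by
    have := Real.log_le_log (by norm_num) hL2
    linarith [Real.log_two_gt_d9]
  have hlog : Real.log (L₀ / 2) ≤ Real.log L₀ :=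
    Real.log_le_log (by linarith) (by linarith)
  have main : ∫⁻ p in DR 1, ENNReal.ofReal (|u p.1 - u p.2| ^ 2 / ‖p.1 - p.2‖ ^ 3)
      ≤ ENNReal.ofReal (C₀ * Real.log L₀ * (1 + I)) := by
    refine (setLIntegral_DR_sq_div_le hu huM hL2 hL).trans (ENNReal.ofReal_le_ofReal ?_)
    rw [← hV, ← hI, hC₀, mul_assoc (4 * V), mul_assoc (4 * V)]
    refine mul_le_mul_of_nonneg_left ?_ (by positivity)
    calc _ ≤ (2 * Real.log L₀ + 2 * M * Real.log L₀) * I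
          + 8 * M ^ 2 * V * (2 * Real.log L₀) := by
          refine add_le_add ?_ (le_mul_of_one_le_right (by positivity) (by linarith))
          gcongr
          linarith
      _ ≤ _ := by
          have h₁ : 0 ≤ Real.log L₀ * (2 + 2 * M) := mul_nonneg (by linarith) (by positivity)
          have h₂ : 0 ≤ Real.log L₀ * (16 * M ^ 2 * V) * I :=
            mul_nonneg (mul_nonneg (by linarith) (by positivity)) hI0
          linarith
  have hpos : 0 ≤ Real.log L₀ * (1 + I) := mul_nonneg (by linarith) (by linarith)
  refine ⟨main.trans (ENNReal.ofReal_le_ofReal ?_), fun β hβ _ v hv => ?_⟩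
  · rw [mul_assoc C₀, mul_assoc (_ + 1)]
    exact mul_le_mul_of_nonneg_right (by nlinarith) hpos
  · have hvK : ∀ θ, 9 * v θ ≤ K := fun θ => by
      have := hv.abs_le (K := (2 / 3 : ℝ) ^ (-(5 : ℝ) / 2)) (fun s => by
        rw [abs_of_nonneg (fker_nonneg (by linarith) s)]
        exact fker_le hβ s) θ
      linarith [le_abs_self (v θ)]
    refine (nEnergy_le_mul hK0 hvK u 1).trans ((mul_le_mul_right main _).trans ?_)
    rw [← ENNReal.ofReal_mul hK0]
    refine ENNReal.ofReal_le_ofReal ?_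
    rw [mul_assoc C₀, ← mul_assoc K, mul_assoc (_ + 1)]
    exact mul_le_mul_of_nonneg_right (by nlinarith) hpos
end
end
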